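/- arXiv:0801.3345 — 13 statements merged into one kernel-verified Lean document; each statement's English description precedes it below -/
import Mathlib

section
/- Let A be an associative unital ℂ-algebra, q ∈ ℂ nonzero, and j = e^{2πi/3}. Suppose a, β, γ, d ∈ A satisfy the GL_{q,j}(1|1) relations, and suppose x, θ ∈ A satisfy xθ = qθx and θ³ = 0, where the entries j-commute with the coordinates as follows: a and d commute with x and θ, β and γ commute with x, θβ = j²βθ, and θγ = jγθ. Then the transformed coordinates x̃ = a x + β θ and θ̃ = γ x + d θ again satisfy the quantum superplane relations: x̃θ̃ = q θ̃ x̃ and θ̃³ = 0. -/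
/-- The `GL_{q,j}(1|1)` relations for the entries `a, β, γ, d` of a Z₃-graded
quantum supermatrix with entries in a ℂ-algebra `A`. -/
def GLRel {A : Type*} [Ring A] [Algebra ℂ A] (q j : ℂ) (a β γ d : A) : Prop :=
  a * β = (q⁻¹ * j⁻¹) • (β * a) ∧
  d * β = (q⁻¹ * j) • (β * d) ∧
  a * γ = q • (γ * a) ∧
  d * γ = q • (γ * d) ∧
  a * d = d * a + (q⁻¹ * (1 - j)) • (β * γ) ∧
  β * γ = (q ^ 2) • (γ * β) ∧
  β ^ 3 = 0 ∧ γ ^ 3 = 0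

theorem cube_aux {A : Type*} [Ring A] [Algebra ℂ A] (j : ℂ) (hs : j ^ 2 + j + 1 = 0)
    (u v : A) (hu : u ^ 3 = 0) (hv : v ^ 3 = 0) (h : v * u = j • (u * v)) :
    (u + v) ^ 3 = 0 := by
  have h1 : u * v * u = j • (u * u * v) := by
    rw [mul_assoc, h, mul_smul_comm, mul_assoc]
  have h2 : v * u * u = (j ^ 2) • (u * u * v) := by
    rw [h, smul_mul_assoc, h1, smul_smul, sq]
  have h3 : v * u * v = j • (u * v * v) := by
    rw [h, smul_mul_assoc]
  have h4 : v * v * u = (j ^ 2) • (u * v * v) := by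
    rw [mul_assoc, h, mul_smul_comm, ← mul_assoc, h3, smul_smul, sq]
  have e : (u + v) ^ 3 = u ^ 3 + (u * u * v + u * v * u + v * u * u)
      + (u * v * v + v * u * v + v * v * u) + v ^ 3 := by
    noncomm_ring
  have k : ∀ w : A, w + j • w + (j ^ 2) • w = 0 := by
    intro w
    have : w + j • w + (j ^ 2) • w = (j ^ 2 + j + 1) • w := by module
    rw [this, hs, zero_smul]
  rw [e, hu, hv, h1, h2, h3, h4, k, k]
  simp

theorem transformed_coordinates_satisfy_superplane_relations
    {A : Type*} [Ring A] [Algebra ℂ A] (q j : ℂ) (hq : q ≠ 0)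
    (hj : j = Complex.exp (2 * Real.pi * Complex.I / 3))
    (a β γ d x θ : A)
    (hT : GLRel q j a β γ d)
    (hxθ : x * θ = q • (θ * x)) (hθ3 : θ ^ 3 = 0)
    (hax : a * x = x * a) (haθ : a * θ = θ * a)
    (hdx : d * x = x * d) (hdθ : d * θ = θ * d)
    (hβx : β * x = x * β) (hγx : γ * x = x * γ)
    (hθβ : θ * β = (j ^ 2) • (β * θ)) (hθγ : θ * γ = j • (γ * θ)) :
    (a * x + β * θ) * (γ * x + d * θ) = q • ((γ * x + d * θ) * (a * x + β * θ)) ∧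
    (γ * x + d * θ) ^ 3 = 0 := by
  obtain ⟨-, h2, h3, h4, h5, h6, -, h8⟩ := hT
  have hprim : IsPrimitiveRoot j 3 := by
    rw [hj]
    exact_mod_cast Complex.isPrimitiveRoot_exp 3 (by norm_num)
  have hj3 : j ^ 3 = 1 := hprim.pow_eq_one
  have hs : j ^ 2 + j + 1 = 0 := by
    have := hprim.geom_sum_eq_zero (by norm_num)
    simp [Finset.sum_range_succ] at this
    linear_combination this
  -- normal forms
  have n1 : (a * x) * (γ * x) = q • (γ * a * (x * x)) := by
    rw [mul_assoc a, ← mul_assoc x, ← hγx, mul_assoc γ, ← mul_assoc a, h3, smul_mul_assoc]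
  have n2 : (a * x) * (d * θ) = q • (a * d * (θ * x)) := by
    rw [mul_assoc a, ← mul_assoc x, ← hdx, mul_assoc d, ← mul_assoc a, hxθ, mul_smul_comm]
  have n3 : (β * θ) * (γ * x) = j • (β * γ * (θ * x)) := by
    rw [mul_assoc β, ← mul_assoc θ, hθγ, smul_mul_assoc, mul_smul_comm, mul_assoc γ,
      ← mul_assoc β]
  have n4 : (β * θ) * (d * θ) = β * d * (θ * θ) := by
    rw [mul_assoc β, ← mul_assoc θ, ← hdθ, mul_assoc d, ← mul_assoc β]
  have m1 : (γ * x) * (a * x) = γ * a * (x * x) := by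
    rw [mul_assoc γ, ← mul_assoc x, ← hax, mul_assoc a, ← mul_assoc γ]
  have m2 : (γ * x) * (β * θ) = q • (γ * β * (θ * x)) := by
    rw [mul_assoc γ, ← mul_assoc x, ← hβx, mul_assoc β, ← mul_assoc γ, hxθ, mul_smul_comm]
  have m3 : (d * θ) * (a * x) = d * a * (θ * x) := by
    rw [mul_assoc d, ← mul_assoc θ, ← haθ, mul_assoc a, ← mul_assoc d]
  have m4 : (d * θ) * (β * θ) = (q⁻¹ * j ^ 3) • (β * d * (θ * θ)) := by
    rw [mul_assoc d, ← mul_assoc θ, hθβ, smul_mul_assoc, mul_smul_comm, mul_assoc β,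
      ← mul_assoc d, h2, smul_mul_assoc, smul_smul]
    congr 1
    ring
  constructor
  · rw [add_mul, mul_add, mul_add, add_mul, mul_add, mul_add, n1, n2, n3, n4, m1, m2, m3, m4,
      h5, h6, hj3]
    simp only [add_mul, smul_mul_assoc]
    match_scalars <;> field_simp <;> ring
  · apply cube_aux j hs
    · have c : Commute γ x := hγx
      rw [c.mul_pow, h8, zero_mul]
    · have c : Commute d θ := hdθ
      rw [c.mul_pow, hθ3, mul_zero]
    · have p1 : (d * θ) * (γ * x) = (j * q) • (γ * d * (θ * x)) := by
        rw [mul_assoc d, ← mul_assoc θ, hθγ, smul_mul_assoc, mul_smul_comm, mul_assoc γ,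
          ← mul_assoc d, h4, smul_mul_assoc, smul_smul]
      have p2 : (γ * x) * (d * θ) = q • (γ * d * (θ * x)) := by
        rw [mul_assoc γ, ← mul_assoc x, ← hdx, mul_assoc d, ← mul_assoc γ, hxθ, mul_smul_comm]
      rw [p1, p2, smul_smul]
end

section
/- Let A be an associative unital ℂ-algebra, q ∈ ℂ nonzero, and j = e^{2πi/3}. Suppose a, β, γ, d ∈ A satisfy the GL_{q,j}(1|1) relations, and suppose φ, y ∈ A satisfy φy = qj yφ and φ³ = 0, where the entries j-commute with the dual coordinates as follows: a and d commute with φ and y, φβ = j²βφ, φγ = jγφ, yβ = jβy, and yγ = j²γy. Then the transformed coordinates φ̃ = a φ + j² β y and ỹ = j γ φ + d y again satisfy the dual quantum superplane relations: φ̃ỹ = qj ỹφ̃ and φ̃³ = 0. -/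
theorem transformed_dual_coordinates_satisfy_dual_superplane_relations
    {A : Type*} [Ring A] [Algebra ℂ A] (q j : ℂ) (hq : q ≠ 0)
    (hj : j = Complex.exp (2 * Real.pi * Complex.I / 3))
    (a β γ d φ y : A)
    (hT : GLRel q j a β γ d)
    (hφy : φ * y = (q * j) • (y * φ)) (hφ3 : φ ^ 3 = 0)
    (haφ : a * φ = φ * a) (hay : a * y = y * a)
    (hdφ : d * φ = φ * d) (hdy : d * y = y * d)
    (hφβ : φ * β = (j ^ 2) • (β * φ)) (hφγ : φ * γ = j • (γ * φ))
    (hyβ : y * β = j • (β * y)) (hyγ : y * γ = (j ^ 2) • (γ * y)) :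
    (a * φ + (j ^ 2) • (β * y)) * (j • (γ * φ) + d * y) =
      (q * j) • ((j • (γ * φ) + d * y) * (a * φ + (j ^ 2) • (β * y))) ∧
    (a * φ + (j ^ 2) • (β * y)) ^ 3 = 0 := by
  have hj0 : j ≠ 0 := by rw [hj]; exact Complex.exp_ne_zero _
  have hprim : IsPrimitiveRoot j 3 := by
    rw [hj]
    have h := Complex.isPrimitiveRoot_exp 3 (by norm_num)
    exact_mod_cast h
  have hj3 : j ^ 3 = 1 := hprim.pow_eq_one
  have hsum : 1 + j + j ^ 2 = 0 := by
    have h1 : j - 1 ≠ 0 := sub_ne_zero.mpr (hprim.ne_one (by norm_num))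
    apply mul_left_cancel₀ h1
    linear_combination hj3
  obtain ⟨haβ, hdβ, haγ, hdγ, had, hβγ, hβ3, hγ3⟩ := hT
  have assoc : ∀ {u v w : A}, u * v = w → ∀ z : A, u * (v * z) = w * z := by
    intro u v w h z
    rw [← mul_assoc, h]
  constructor
  · have e1 : (a * φ) * (j • (γ * φ)) = (j ^ 2 * q) • (γ * (a * (φ * φ))) := by
      simp only [mul_assoc, mul_smul_comm, smul_mul_assoc, smul_smul, assoc hφγ, assoc haγ]
      congr 1; ring
    have e2 : (a * φ) * (d * y) =
        (q * j) • (d * (a * (y * φ))) + (j * (1 - j)) • (β * (γ * (y * φ))) := by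
      simp only [mul_assoc, mul_smul_comm, smul_mul_assoc, smul_smul, assoc hdφ.symm, hφy,
        assoc had, add_mul, smul_add]
      congr 2; field_simp
    have e3 : ((j ^ 2) • (β * y)) * (j • (γ * φ)) = (j ^ 2) • (β * (γ * (y * φ))) := by
      simp only [mul_assoc, mul_smul_comm, smul_mul_assoc, smul_smul, assoc hyγ]
      congr 1; linear_combination j ^ 2 * hj3
    have e4 : ((j ^ 2) • (β * y)) * (d * y) = (j ^ 2) • (β * (d * (y * y))) := by
      simp only [mul_assoc, smul_mul_assoc, assoc hdy.symm]
    have f1 : (j • (γ * φ)) * (a * φ) = j • (γ * (a * (φ * φ))) := by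
      simp only [mul_assoc, smul_mul_assoc, assoc haφ.symm]
    have f2 : (j • (γ * φ)) * ((j ^ 2) • (β * y)) = q⁻¹ • (β * (γ * (y * φ))) := by
      simp only [mul_assoc, mul_smul_comm, smul_mul_assoc, smul_smul, assoc hφβ, hφy, assoc hβγ]
      congr 1; field_simp; linear_combination (j ^ 3 + 1) * hj3
    have f3 : (d * y) * (a * φ) = d * (a * (y * φ)) := by
      simp only [mul_assoc, assoc hay.symm]
    have f4 : (d * y) * ((j ^ 2) • (β * y)) = (q⁻¹ * j) • (β * (d * (y * y))) := by
      simp only [mul_assoc, mul_smul_comm, smul_mul_assoc, smul_smul, assoc hyβ, assoc hdβ]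
      congr 1; linear_combination q⁻¹ * j * hj3
    simp only [add_mul, mul_add, e1, e2, e3, e4, f1, f2, f3, f4]
    match_scalars <;> field_simp <;> ring
  · have hXY : (a * φ) * ((j ^ 2) • (β * y)) = (j ^ 2) • (((j ^ 2) • (β * y)) * (a * φ)) := by
      simp only [mul_assoc, mul_smul_comm, smul_mul_assoc, smul_smul, assoc hφβ, assoc haβ, hφy,
        assoc hay.symm]
      congr 1; field_simp
    have hX3 : (a * φ) ^ 3 = 0 := by
      rw [(show Commute a φ from haφ).mul_pow, hφ3, mul_zero]
    have hβ3' : β * (β * β) = 0 := by rw [← hβ3]; noncomm_ring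
    have hY3 : ((j ^ 2) • (β * y)) ^ 3 = 0 := by
      have : (β * y) ^ 3 = (j ^ 3) • ((β * (β * β)) * (y * (y * y))) := by
        simp only [pow_succ, pow_zero, one_mul, mul_assoc, mul_smul_comm, smul_mul_assoc,
          smul_smul, assoc hyβ]
      rw [smul_pow, this, hβ3', zero_mul, smul_zero, smul_zero]
    generalize a * φ = X at *
    generalize (j ^ 2) • (β * y) = Y at *
    have key : (X + Y) ^ 3 = X ^ 3 + Y ^ 3 + (X * (X * Y) + X * (Y * X) + Y * (X * X))
        + (X * (Y * Y) + Y * (X * Y) + Y * (Y * X)) := by noncomm_ring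
    rw [key, hX3, hY3]
    simp only [hXY, assoc hXY, mul_smul_comm, smul_mul_assoc, smul_smul, mul_assoc]
    match_scalars <;> linear_combination hsum + j * hj3
end

section
/- Let A be an associative unital ℂ-algebra, q ∈ ℂ nonzero, and j = e^{2πi/3}. Suppose a, β, γ, d ∈ A satisfy the GL_{q,j}(1|1) relations and a and d are units of A. Define the Z₃-graded quantum superdeterminant D = a d⁻¹ + a d⁻¹ γ a⁻¹ β d⁻¹ + a d⁻¹ γ a⁻¹ β d⁻¹ γ a⁻¹ β d⁻¹. Then: a D = D a, β D = j² D β, γ D = D γ, and d a D = D a d. -/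
/-- Tail version of a `q`-commutation rule. -/
theorem tail_rule {A : Type*} [Ring A] [Algebra ℂ A] {r : ℂ} {x y : A}
    (h : x * y = r • (y * x)) (z : A) : x * (y * z) = r • (y * (x * z)) := by
  rw [← mul_assoc, h, smul_mul_assoc, mul_assoc]

/-- Inverting the left factor of a `q`-commutation rule. -/
theorem inv_rule {A : Type*} [Ring A] [Algebra ℂ A] {r s : ℂ} {x xi y : A}
    (hs : s * r = 1) (h1 : x * xi = 1) (h2 : xi * x = 1)
    (h : x * y = r • (y * x)) : xi * y = s • (y * xi) := by
  have : s • (xi * (x * y) * xi) = s • (xi * (r • (y * x)) * xi) := by rw [h]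
  rw [← mul_assoc xi x y, h2, one_mul, mul_smul_comm, smul_mul_assoc, smul_smul, hs, one_smul,
    mul_assoc xi, mul_assoc y, h1, mul_one] at this
  exact this.symm

/-- If `y E = s E y` then `D y = s y D` for `D` inverse to `E`. -/
theorem conj_rule {A : Type*} [Ring A] [Algebra ℂ A] {s : ℂ} {D E y : A}
    (h1 : D * E = 1) (h2 : E * D = 1) (h : E * y = s • (y * E)) : y * D = s • (D * y) := by
  have : D * (E * y) * D = D * (s • (y * E)) * D := by rw [h]
  rw [← mul_assoc D E y, h1, one_mul, mul_smul_comm, smul_mul_assoc, mul_assoc D,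
    mul_assoc y, h2, mul_one] at this
  exact this

theorem superdeterminant_commutation_relations
    {A : Type*} [Ring A] [Algebra ℂ A] (q j : ℂ) (hq : q ≠ 0)
    (hj : j = Complex.exp (2 * Real.pi * Complex.I / 3))
    (a β γ d ai di : A)
    (hT : GLRel q j a β γ d)
    (hai : a * ai = 1) (hai' : ai * a = 1)
    (hdi : d * di = 1) (hdi' : di * d = 1) :
    let D := a * di + a * di * γ * ai * β * di + a * di * γ * ai * β * di * γ * ai * β * di
    a * D = D * a ∧ β * D = (j ^ 2) • (D * β) ∧ γ * D = D * γ ∧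
      d * a * D = D * (a * d) := by
  intro D
  obtain ⟨haβ, hdβ, haγ, hdγ, had, hβγ, hβ3, hγ3⟩ := hT
  have hprim : IsPrimitiveRoot j 3 := by
    rw [hj]; exact_mod_cast Complex.isPrimitiveRoot_exp 3 (by norm_num)
  have hj3 : j ^ 3 = 1 := hprim.pow_eq_one
  have hj1 : j ≠ 1 := hprim.ne_one (by norm_num)
  have hjs : j ^ 2 = -1 - j := by
    have h : (j - 1) * (j ^ 2 + j + 1) = 0 := by linear_combination hj3
    rcases mul_eq_zero.1 h with h | h
    · exact absurd (sub_eq_zero.1 h) hj1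
    · linear_combination h
  have hj0 : j ≠ 0 := by rintro rfl; norm_num at hj3
  have hji : j⁻¹ = j ^ 2 := by field_simp; exact hj3.symm
  rw [hji] at haβ
  clear hj hprim
  have hiβ : ai * β = (q * j) • (β * ai) :=
    inv_rule (by field_simp; linear_combination hj3) hai hai' haβ
  have hiγ : ai * γ = q⁻¹ • (γ * ai) := inv_rule (by field_simp) hai hai' haγ
  have heβ : di * β = (q * j ^ 2) • (β * di) :=
    inv_rule (by field_simp; linear_combination hj3) hdi hdi' hdβ
  have heγ : di * γ = q⁻¹ • (γ * di) := inv_rule (by field_simp) hdi hdi' hdγ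
  have hc (x y z : A) (h : x * y = 1) : x * (y * z) = z := by rw [← mul_assoc, h, one_mul]
  have had1 : a * d = d * a + (q * (1 - j)) • (γ * β) := by
    rw [had, hβγ, smul_smul]; congr 2; field_simp
  have had2 (z : A) : a * (d * z) = d * (a * z) + (q * (1 - j)) • (γ * (β * z)) := by
    rw [← mul_assoc, had1, add_mul, smul_mul_assoc, mul_assoc, mul_assoc]
  have hid1 : ai * d = d * ai - (q * (1 - j) * j) • (γ * (β * (ai * ai))) := by
    have h : ai * (a * d) * ai = ai * (d * a + (q * (1 - j)) • (γ * β)) * ai := by rw [had1]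
    simp only [mul_add, add_mul, mul_assoc, hc _ _ _ hai', hai, mul_one, mul_smul_comm,
      smul_mul_assoc, tail_rule hiγ, tail_rule hiβ, smul_smul] at h
    rw [h, add_sub_assoc, left_eq_add, sub_eq_zero]
    congr 1; field_simp
  have hid2 (z : A) : ai * (d * z) =
      d * (ai * z) - (q * (1 - j) * j) • (γ * (β * (ai * (ai * z)))) := by
    rw [← mul_assoc, hid1, sub_mul, smul_mul_assoc]; simp only [mul_assoc]
  have hγ3' (z : A) : γ * (γ * (γ * z)) = 0 := by
    have : γ * (γ * (γ * z)) = γ ^ 3 * z := by simp only [pow_succ, pow_zero, one_mul, mul_assoc]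
    rw [this, hγ3, zero_mul]
  obtain ⟨X, hX⟩ : ∃ X, X = γ * ai * β * di := ⟨_, rfl⟩
  obtain ⟨E, hE⟩ : ∃ E, E = d * ai - γ * ai * β * ai := ⟨_, rfl⟩
  have hX3 : X * X * X = 0 := by
    rw [hX]
    simp only [mul_assoc, mul_smul_comm, smul_mul_assoc, tail_rule hiγ, tail_rule hiβ,
      tail_rule heγ, tail_rule heβ, tail_rule hβγ, hγ3', smul_zero, mul_zero]
  have hDX : D = a * di * (1 + X + X * X) := by
    simp only [D, hX]; noncomm_ring
  have hEX : E = (1 - X) * (d * ai) := by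
    rw [hE, hX]; simp only [sub_mul, one_mul, mul_assoc, hc _ _ _ hdi']
  have hDE : D * E = 1 := by
    have : D * E = a * di * (1 - X * X * X) * (d * ai) := by rw [hDX, hEX]; noncomm_ring
    rw [this, hX3, sub_zero, mul_one]; simp only [mul_assoc, hc _ _ _ hdi', hai]
  have hED : E * D = 1 := by
    have : E * D = (1 - X) * (d * (ai * a) * di) * (1 + X + X * X) := by
      rw [hDX, hEX]; noncomm_ring
    rw [this, hai', mul_one, hdi, mul_one]
    have : (1 - X) * (1 + X + X * X) = 1 - X * X * X := by noncomm_ring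
    rw [this, hX3, sub_zero]
  have hEn : E = d * ai - (q * j) • (γ * (β * (ai * ai))) := by
    rw [hE]; simp only [mul_assoc, tail_rule hiβ, mul_smul_comm]
  clear_value D
  have hEa : E * a = (1 : ℂ) • (a * E) := by
    rw [hEn]
    simp only [mul_sub, sub_mul, mul_add, add_mul, mul_assoc, mul_smul_comm, smul_mul_assoc,
      haβ, hdβ, haγ, hdγ, hβγ, hiβ, hiγ, tail_rule haβ, tail_rule hdβ, tail_rule haγ,
      tail_rule hdγ, tail_rule hβγ, tail_rule hiβ, tail_rule hiγ, had1, had2, hid1, hid2,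
      hai, hai', hc _ _ _ hai, hc _ _ _ hai', mul_one]
    match_scalars <;> field_simp <;> grind
  have hEβ : E * β = (j ^ 2) • (β * E) := by
    rw [hEn]
    simp only [mul_sub, sub_mul, mul_add, add_mul, mul_assoc, mul_smul_comm, smul_mul_assoc,
      haβ, hdβ, haγ, hdγ, hβγ, hiβ, hiγ, tail_rule haβ, tail_rule hdβ, tail_rule haγ,
      tail_rule hdγ, tail_rule hβγ, tail_rule hiβ, tail_rule hiγ, had1, had2, hid1, hid2,
      hai, hai', hc _ _ _ hai, hc _ _ _ hai', mul_one]
    match_scalars <;> field_simp <;> grind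
  have hEγ : E * γ = (1 : ℂ) • (γ * E) := by
    rw [hEn]
    simp only [mul_sub, sub_mul, mul_add, add_mul, mul_assoc, mul_smul_comm, smul_mul_assoc,
      haβ, hdβ, haγ, hdγ, hβγ, hiβ, hiγ, tail_rule haβ, tail_rule hdβ, tail_rule haγ,
      tail_rule hdγ, tail_rule hβγ, tail_rule hiβ, tail_rule hiγ, had1, had2, hid1, hid2,
      hai, hai', hc _ _ _ hai, hc _ _ _ hai', mul_one]
    match_scalars <;> field_simp <;> grind
  have hEd : E * (d * a) = a * d * E := by
    rw [hEn]
    simp only [mul_sub, sub_mul, mul_add, add_mul, mul_assoc, mul_smul_comm, smul_mul_assoc,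
      haβ, hdβ, haγ, hdγ, hβγ, hiβ, hiγ, tail_rule haβ, tail_rule hdβ, tail_rule haγ,
      tail_rule hdγ, tail_rule hβγ, tail_rule hiβ, tail_rule hiγ, had1, had2, hid1, hid2,
      hai, hai', hc _ _ _ hai, hc _ _ _ hai', mul_one]
    match_scalars <;> field_simp <;> grind
  refine ⟨?_, conj_rule hDE hED hEβ, ?_, ?_⟩
  · simpa using conj_rule hDE hED hEa
  · simpa using conj_rule hDE hED hEγ
  · calc d * a * D = D * (E * (d * a)) * D := by rw [← mul_assoc D E, hDE, one_mul]
      _ = D * (a * d) * (E * D) := by rw [hEd]; simp only [mul_assoc]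
      _ = D * (a * d) := by rw [hED, mul_one]
end

section
/- Let A be an associative unital ℂ-algebra, q ∈ ℂ nonzero, and j = e^{2πi/3}. Suppose a, β, γ, d ∈ A satisfy the GL_{q,j}(1|1) relations. Define Δ₁ = a d − q⁻¹ β γ and Δ₂ = d a − q j γ β. Then: Δ₁ a = a Δ₁, Δ₁ d = d Δ₁, Δ₂ a = a Δ₂, Δ₂ d = d Δ₂, Δₖ β = q⁻² β Δₖ and Δₖ γ = q² γ Δₖ for k = 1, 2, and Δ₁ Δ₂ = Δ₂ Δ₁. -/
theorem quantum_minors_commutation_relations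
    {A : Type*} [Ring A] [Algebra ℂ A] (q j : ℂ) (hq : q ≠ 0)
    (hj : j = Complex.exp (2 * Real.pi * Complex.I / 3))
    (a β γ d : A)
    (hT : GLRel q j a β γ d) :
    let Δ₁ := a * d - q⁻¹ • (β * γ)
    let Δ₂ := d * a - (q * j) • (γ * β)
    Δ₁ * a = a * Δ₁ ∧ Δ₁ * d = d * Δ₁ ∧
    Δ₂ * a = a * Δ₂ ∧ Δ₂ * d = d * Δ₂ ∧
    Δ₁ * β = (q ^ (-2 : ℤ)) • (β * Δ₁) ∧ Δ₂ * β = (q ^ (-2 : ℤ)) • (β * Δ₂) ∧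
    Δ₁ * γ = (q ^ 2) • (γ * Δ₁) ∧ Δ₂ * γ = (q ^ 2) • (γ * Δ₂) ∧
    Δ₁ * Δ₂ = Δ₂ * Δ₁ := by
  obtain ⟨hab, hdb, hag, hdg, had, hbg, -, -⟩ := hT
  have hj0 : j ≠ 0 := by rw [hj]; exact Complex.exp_ne_zero _
  intro Δ₁ Δ₂
  have hE : Δ₂ = Δ₁ := by
    change d * a - (q * j) • (γ * β) = a * d - q⁻¹ • (β * γ)
    rw [had, hbg]
    match_scalars <;> field_simp <;> ring
  have habg : a * (β * γ) = j⁻¹ • (β * γ * a) := by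
    rw [← mul_assoc, hab, smul_mul_assoc, mul_assoc, hag, mul_smul_comm, smul_smul, ← mul_assoc]
    congr 1
    field_simp
  have hdbg : d * (β * γ) = j • (β * γ * d) := by
    rw [← mul_assoc, hdb, smul_mul_assoc, mul_assoc, hdg, mul_smul_comm, smul_smul, ← mul_assoc]
    congr 1
    field_simp
  have h1 : Δ₁ * a = a * Δ₁ := by
    change (a * d - q⁻¹ • (β * γ)) * a = a * (a * d - q⁻¹ • (β * γ))
    have e : a * (a * d) = a * d * a + (q⁻¹ * (1 - j) * j⁻¹) • (β * γ * a) := by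
      conv_lhs => rw [had]
      rw [mul_add, mul_smul_comm, habg, smul_smul, mul_assoc a d a]
    rw [sub_mul, mul_sub, e, mul_smul_comm, habg, smul_mul_assoc]
    match_scalars <;> field_simp <;> ring
  have h2 : Δ₁ * d = d * Δ₁ := by
    change (a * d - q⁻¹ • (β * γ)) * d = d * (a * d - q⁻¹ • (β * γ))
    have e : a * d * d = d * (a * d) + (q⁻¹ * (1 - j)) • (β * γ * d) := by
      conv_lhs => rw [had]
      rw [add_mul, smul_mul_assoc, mul_assoc d a d]
    rw [sub_mul, mul_sub, e, mul_smul_comm, hdbg, smul_mul_assoc]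
    match_scalars <;> field_simp <;> ring
  have h3 : Δ₁ * β = (q ^ (-2 : ℤ)) • (β * Δ₁) := by
    change (a * d - q⁻¹ • (β * γ)) * β = (q ^ (-2 : ℤ)) • (β * (a * d - q⁻¹ • (β * γ)))
    have e : a * d * β = (q⁻¹ * j * (q⁻¹ * j⁻¹)) • (β * (a * d)) := by
      rw [mul_assoc, hdb, mul_smul_comm, ← mul_assoc, hab, smul_mul_assoc, smul_smul, mul_assoc β a d]
    rw [sub_mul, mul_sub, e, smul_mul_assoc, mul_smul_comm, hbg, mul_smul_comm, smul_mul_assoc,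
      ← mul_assoc β γ β, hbg, smul_mul_assoc]
    match_scalars <;> field_simp
  have h4 : Δ₁ * γ = (q ^ 2) • (γ * Δ₁) := by
    change (a * d - q⁻¹ • (β * γ)) * γ = (q ^ 2) • (γ * (a * d - q⁻¹ • (β * γ)))
    have e : a * d * γ = (q * q) • (γ * (a * d)) := by
      rw [mul_assoc, hdg, mul_smul_comm, ← mul_assoc, hag, smul_mul_assoc, smul_smul, mul_assoc]
    have e2 : β * γ * γ = q ^ 2 • (γ * (β * γ)) := by
      conv_lhs => rw [hbg]
      rw [smul_mul_assoc, mul_assoc]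
    rw [sub_mul, mul_sub, e, smul_mul_assoc, mul_smul_comm, e2]
    match_scalars <;> field_simp
  rw [hE]
  exact ⟨h1, h2, h1, h2, h3, h3, h4, h4, rfl⟩
end

section
/- Let A be an associative unital ℂ-algebra, q ∈ ℂ nonzero, and j = e^{2πi/3}. Suppose a, β, γ, d ∈ A satisfy the GL_{q,j}(1|1) relations, a and d are units of A, and Δ₂ = d a − q j γ β is a unit of A. Then the Z₃-graded quantum superdeterminant satisfies a d⁻¹ + a d⁻¹ γ a⁻¹ β d⁻¹ + a d⁻¹ γ a⁻¹ β d⁻¹ γ a⁻¹ β d⁻¹ = a² Δ₂⁻¹. -/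
/-- A skew-commutation relation passes to the inverse. -/
lemma skew_inv {A : Type*} [Ring A] [Algebra ℂ A] {c : ℂ} (hc : c ≠ 0) {x xi y : A}
    (h1 : x * xi = 1) (h2 : xi * x = 1) (h : x * y = c • (y * x)) :
    xi * y = c⁻¹ • (y * xi) := by
  have h3 : y * xi = c • (xi * y) := by
    calc y * xi = xi * (x * y) * xi := by rw [← mul_assoc, h2, one_mul]
      _ = c • (xi * y * (x * xi)) := by
        rw [h]; simp only [mul_smul_comm, smul_mul_assoc, mul_assoc]
      _ = c • (xi * y) := by rw [h1, mul_one]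
  rw [h3, smul_smul, inv_mul_cancel₀ hc, one_smul]

lemma skew_mul {A : Type*} [Ring A] [Algebra ℂ A] {c c' : ℂ} {x x' y : A}
    (h : x * y = c • (y * x)) (h' : x' * y = c' • (y * x')) :
    (x * x') * y = (c' * c) • (y * (x * x')) := by
  rw [mul_assoc, h', mul_smul_comm, ← mul_assoc, h, smul_mul_assoc, smul_smul, mul_assoc]

lemma skew_cube {A : Type*} [Ring A] [Algebra ℂ A] {c : ℂ} {W g : A}
    (h : W * g = c • (g * W)) (hg : g ^ 3 = 0) : (g * W) ^ 3 = 0 := by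
  have h2 : W * (g * W) = c • (g * (W * W)) := by
    rw [← mul_assoc, h, smul_mul_assoc, mul_assoc]
  have h3 : (W * W) * g = (c * c) • (g * (W * W)) := skew_mul h h
  calc (g * W) ^ 3 = g * (W * (g * W)) * (g * W) := by simp only [pow_succ, pow_zero, one_mul, mul_assoc]
    _ = c • (g * g * ((W * W) * g) * W) := by
      rw [h2]; simp only [mul_smul_comm, smul_mul_assoc, mul_assoc]
    _ = (c * (c * c)) • (g ^ 3 * (W * W * W)) := by
      rw [h3]; simp only [mul_smul_comm, smul_mul_assoc, smul_smul, pow_succ, pow_zero, one_mul, mul_assoc]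
    _ = 0 := by rw [hg, zero_mul, smul_zero]

theorem superdeterminant_eq_a_sq_mul_inv_Delta2
    {A : Type*} [Ring A] [Algebra ℂ A] (q j : ℂ) (hq : q ≠ 0)
    (hj : j = Complex.exp (2 * Real.pi * Complex.I / 3))
    (a β γ d ai di e₂ : A)
    (hT : GLRel q j a β γ d)
    (hai : a * ai = 1) (hai' : ai * a = 1)
    (hdi : d * di = 1) (hdi' : di * d = 1)
    (he₂ : (d * a - (q * j) • (γ * β)) * e₂ = 1)
    (he₂' : e₂ * (d * a - (q * j) • (γ * β)) = 1) :
    a * di + a * di * γ * ai * β * di + a * di * γ * ai * β * di * γ * ai * β * di =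
      a ^ 2 * e₂ := by
  have hj0 : j ≠ 0 := by rw [hj]; exact Complex.exp_ne_zero _
  obtain ⟨hab, -, hag, hdg, -, hbg, -, hg⟩ := hT
  have h1 := skew_inv hq hai hai' hag
  have h2 := skew_inv hq hdi hdi' hdg
  have hb : ai * β = (q * j) • (β * ai) := by
    have := skew_inv (by simp [hq, hj0]) hai hai' hab
    rwa [mul_inv, inv_inv, inv_inv] at this
  have hX := skew_cube (skew_mul (skew_mul h1 hbg) h2) hg
  set X := γ * (ai * β * di) with hXd
  have hXdd : X * d = (q * j) • (γ * β * ai) := by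
    rw [hXd, mul_assoc, mul_assoc (ai * β), hdi', mul_one, hb, mul_smul_comm, mul_assoc]
  have hs : (1 - X) * d = (d * a - (q * j) • (γ * β)) * ai := by
    rw [sub_mul, one_mul, hXdd, sub_mul, mul_assoc d, hai, mul_one, smul_mul_assoc]
  have hl : (a * e₂) * ((1 - X) * d) = 1 := by
    rw [hs, mul_assoc, ← mul_assoc e₂, he₂', one_mul, hai]
  have hr : ((1 - X) * d) * (di * (1 + X + X ^ 2)) = 1 := by
    rw [mul_assoc, ← mul_assoc d, hdi, one_mul]
    calc (1 - X) * (1 + X + X ^ 2) = 1 - X ^ 3 := by noncomm_ring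
      _ = 1 := by rw [hX, sub_zero]
  have key := left_inv_eq_right_inv hl hr
  rw [pow_two a, mul_assoc a a e₂, key, hXd]
  simp only [mul_add, mul_one, pow_two, mul_assoc]
end

section
/- Let A be an associative unital ℂ-algebra, q ∈ ℂ nonzero, and j = e^{2πi/3}. Suppose a, β, γ, d ∈ A satisfy the GL_{q,j}(1|1) relations and that Δ₁ = a d − q⁻¹ β γ and Δ₂ = d a − q j γ β are units of A. Then the 2×2 matrix S = [[d Δ₁⁻¹, −q j β Δ₂⁻¹], [−q⁻¹ γ Δ₁⁻¹, a Δ₂⁻¹]] over A is a two-sided inverse of T = [[a, β], [γ, d]], i.e. T S = S T = I as matrices over A. -/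
theorem inverse_matrix_via_quantum_minors
    {A : Type*} [Ring A] [Algebra ℂ A] (q j : ℂ) (hq : q ≠ 0)
    (hj : j = Complex.exp (2 * Real.pi * Complex.I / 3))
    (a β γ d e₁ e₂ : A)
    (hT : GLRel q j a β γ d)
    (he₁ : (a * d - q⁻¹ • (β * γ)) * e₁ = 1)
    (he₁' : e₁ * (a * d - q⁻¹ • (β * γ)) = 1)
    (he₂ : (d * a - (q * j) • (γ * β)) * e₂ = 1)
    (he₂' : e₂ * (d * a - (q * j) • (γ * β)) = 1) :
    let T : Matrix (Fin 2) (Fin 2) A := !![a, β; γ, d]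
    let S : Matrix (Fin 2) (Fin 2) A :=
      !![d * e₁, -((q * j) • (β * e₂)); -(q⁻¹ • (γ * e₁)), a * e₂]
    T * S = 1 ∧ S * T = 1 := by
  have hj0 : j ≠ 0 := by rw [hj]; exact Complex.exp_ne_zero _
  clear hj
  obtain ⟨h1, h2, h3, h4, h5, h6, -, -⟩ := hT
  -- the two minors coincide
  have hD : d * a - (q * j) • (γ * β) = a * d - q⁻¹ • (β * γ) := by
    rw [h5, h6]
    simp only [smul_smul]
    match_scalars <;> field_simp <;> ring
  rw [hD] at he₂ he₂'
  have hee : e₂ = e₁ := by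
    calc e₂ = e₂ * ((a * d - q⁻¹ • (β * γ)) * e₁) := by rw [he₁, mul_one]
      _ = e₁ := by rw [← mul_assoc, he₂', one_mul]
  subst hee
  generalize hΔ : a * d - q⁻¹ • (β * γ) = D at *
  have conj : ∀ (x : A) (c : ℂ), D * x = c • (x * D) → x * e₂ = c • (e₂ * x) := by
    intro x c h
    calc x * e₂ = e₂ * (D * x) * e₂ := by rw [← mul_assoc, he₁', one_mul]
      _ = c • (e₂ * x * (D * e₂)) := by rw [h]; simp only [mul_smul_comm, smul_mul_assoc, mul_assoc]
      _ = c • (e₂ * x) := by rw [he₁, mul_one]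
  have k1 : ∀ x, a * (β * x) = (q⁻¹ * j⁻¹) • (β * (a * x)) := fun x => by
    rw [← mul_assoc, h1, smul_mul_assoc, mul_assoc]
  have k2 : ∀ x, d * (β * x) = (q⁻¹ * j) • (β * (d * x)) := fun x => by
    rw [← mul_assoc, h2, smul_mul_assoc, mul_assoc]
  have k3 : ∀ x, a * (γ * x) = q • (γ * (a * x)) := fun x => by
    rw [← mul_assoc, h3, smul_mul_assoc, mul_assoc]
  have k4 : ∀ x, d * (γ * x) = q • (γ * (d * x)) := fun x => by
    rw [← mul_assoc, h4, smul_mul_assoc, mul_assoc]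
  have k6 : ∀ x, β * (γ * x) = (q ^ 2) • (γ * (β * x)) := fun x => by
    rw [← mul_assoc, h6, smul_mul_assoc, mul_assoc]
  have ca : a * e₂ = (1 : ℂ) • (e₂ * a) := by
    apply conj
    conv_rhs => rw [← hD]
    rw [← hΔ]
    simp only [sub_mul, mul_sub, smul_mul_assoc, mul_smul_comm, mul_assoc, k3, h1, k6, smul_smul,
      smul_sub]
    match_scalars <;> field_simp
  have cd : d * e₂ = (1 : ℂ) • (e₂ * d) := by
    apply conj
    conv_lhs => rw [← hD]
    rw [← hΔ]
    simp only [sub_mul, mul_sub, smul_mul_assoc, mul_smul_comm, mul_assoc, k2, h4, k6, smul_smul,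
      smul_sub]
    match_scalars <;> field_simp
  have cβ : β * e₂ = (q⁻¹ ^ 2) • (e₂ * β) := by
    apply conj
    rw [← hΔ]
    simp only [sub_mul, mul_sub, smul_mul_assoc, mul_smul_comm, mul_assoc, k1, h2, h6, k6, smul_smul,
      smul_sub]
    match_scalars <;> field_simp
  have cγ : γ * e₂ = (q ^ 2) • (e₂ * γ) := by
    apply conj
    rw [← hΔ]
    simp only [sub_mul, mul_sub, smul_mul_assoc, mul_smul_comm, mul_assoc, k3, h4, k6, h6, smul_smul,
      smul_sub]
    match_scalars <;> field_simp
  have t11 : a * (d * e₂) + β * -(q⁻¹ • (γ * e₂)) = 1 := by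
    rw [← he₁, ← hΔ]
    simp only [sub_mul, smul_mul_assoc, mul_smul_comm, mul_neg, mul_assoc]
    abel
  have t12 : a * -((q * j) • (β * e₂)) + β * (a * e₂) = 0 := by
    simp only [mul_neg, mul_smul_comm, k1, smul_smul]
    match_scalars
    field_simp
    ring
  have t21 : γ * (d * e₂) + d * -(q⁻¹ • (γ * e₂)) = 0 := by
    simp only [mul_neg, mul_smul_comm, k4, smul_smul]
    match_scalars
    field_simp
    ring
  have t22 : γ * -((q * j) • (β * e₂)) + d * (a * e₂) = 1 := by
    rw [← he₁, ← hD]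
    simp only [sub_mul, smul_mul_assoc, mul_smul_comm, mul_neg, mul_assoc]
    abel
  have s11 : d * e₂ * a + -((q * j) • (β * e₂)) * γ = 1 := by
    rw [← he₁', ← hD, cd, cβ]
    simp only [mul_sub, smul_mul_assoc, mul_smul_comm, neg_mul, mul_assoc, h6, smul_smul]
    match_scalars <;> field_simp
  have s12 : d * e₂ * β + -((q * j) • (β * e₂)) * d = 0 := by
    rw [cd, cβ]
    simp only [smul_mul_assoc, mul_smul_comm, neg_mul, mul_assoc, h2, smul_smul]
    match_scalars
    field_simp
    ring
  have s21 : -(q⁻¹ • (γ * e₂)) * a + a * e₂ * γ = 0 := by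
    rw [ca, cγ]
    simp only [smul_mul_assoc, mul_smul_comm, neg_mul, mul_assoc, h3, smul_smul]
    match_scalars
    field_simp
    ring
  have s22 : -(q⁻¹ • (γ * e₂)) * β + a * e₂ * d = 1 := by
    rw [← he₁', ← hΔ, ca, cγ]
    simp only [mul_sub, smul_mul_assoc, mul_smul_comm, neg_mul, mul_assoc, h6, smul_smul]
    match_scalars <;> field_simp
  intro T S
  constructor
  · simp only [T, S, Matrix.mul_fin_two, Matrix.one_fin_two, t11, t12, t21, t22]
  · simp only [T, S, Matrix.mul_fin_two, Matrix.one_fin_two, s11, s12, s21, s22]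
end

section
/- Let A be an associative unital ℂ-algebra, q ∈ ℂ nonzero, and j = e^{2πi/3}. Suppose a, β, γ, d ∈ A satisfy the GL_{q,j}(1|1) relations, a and d are units of A, and Δ₁ = a d − q⁻¹ β γ is a unit of A. Then d a⁻¹ + d a⁻¹ β d⁻¹ γ a⁻¹ + d a⁻¹ β d⁻¹ γ a⁻¹ β d⁻¹ γ a⁻¹ = d² Δ₁⁻¹. -/
theorem inverse_superdeterminant_eq_d_sq_mul_inv_Delta1
    {A : Type*} [Ring A] [Algebra ℂ A] (q j : ℂ) (hq : q ≠ 0)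
    (hj : j = Complex.exp (2 * Real.pi * Complex.I / 3))
    (a β γ d ai di e₁ : A)
    (hT : GLRel q j a β γ d)
    (hai : a * ai = 1) (hai' : ai * a = 1)
    (hdi : d * di = 1) (hdi' : di * d = 1)
    (he₁ : (a * d - q⁻¹ • (β * γ)) * e₁ = 1)
    (he₁' : e₁ * (a * d - q⁻¹ • (β * γ)) = 1) :
    d * ai + d * ai * β * di * γ * ai + d * ai * β * di * γ * ai * β * di * γ * ai =
      d ^ 2 * e₁ := by
  obtain ⟨h1, h2, -, h4, -, h6, h7, -⟩ := hT
  have hj0 : j ≠ 0 := by rw [hj]; exact Complex.exp_ne_zero _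
  have A1 : ai * β = (q * j) • (β * ai) := by
    have : β * ai = (q⁻¹ * j⁻¹) • (ai * β) := by
      calc β * ai = ai * (a * β) * ai := by rw [← mul_assoc, hai', one_mul]
        _ = (q⁻¹ * j⁻¹) • (ai * β * (a * ai)) := by
          rw [h1, mul_smul_comm, smul_mul_assoc]; simp only [mul_assoc]
        _ = _ := by rw [hai, mul_one]
    rw [this, smul_smul, show q * j * (q⁻¹ * j⁻¹) = 1 by field_simp, one_smul]
  have A2 : di * β = (q * j⁻¹) • (β * di) := by
    have : β * di = (q⁻¹ * j) • (di * β) := by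
      calc β * di = di * (d * β) * di := by rw [← mul_assoc, hdi', one_mul]
        _ = (q⁻¹ * j) • (di * β * (d * di)) := by
          rw [h2, mul_smul_comm, smul_mul_assoc]; simp only [mul_assoc]
        _ = _ := by rw [hdi, mul_one]
    rw [this, smul_smul, show q * j⁻¹ * (q⁻¹ * j) = 1 by field_simp, one_smul]
  have A3 : γ * β = ((q ^ 2)⁻¹) • (β * γ) := by
    rw [h6, smul_smul, inv_mul_cancel₀ (pow_ne_zero 2 hq), one_smul]
  -- v = ai di γ commutes with β
  have hv : Commute β (ai * di * γ) := by
    symm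
    calc ai * di * γ * β = ai * (di * (γ * β)) := by simp only [mul_assoc]
      _ = (q ^ 2)⁻¹ • (ai * (di * β * γ)) := by
        rw [A3, mul_smul_comm, mul_smul_comm, mul_assoc di]
      _ = ((q ^ 2)⁻¹ * (q * j⁻¹)) • (ai * β * (di * γ)) := by
        rw [A2, smul_mul_assoc, mul_smul_comm, smul_smul]; simp only [mul_assoc]
      _ = ((q ^ 2)⁻¹ * (q * j⁻¹) * (q * j)) • (β * (ai * di * γ)) := by
        rw [A1, smul_mul_assoc, smul_smul]; simp only [mul_assoc]
      _ = _ := by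
        rw [show (q ^ 2)⁻¹ * (q * j⁻¹) * (q * j) = 1 by field_simp, one_smul]
  obtain ⟨u, hu⟩ : ∃ u, u = ai * β * di * γ := ⟨_, rfl⟩
  have hu' : u = (q * j) • (β * (ai * di * γ)) := by
    rw [hu, A1, smul_mul_assoc, smul_mul_assoc]; simp only [mul_assoc]
  have hu3 : u ^ 3 = 0 := by
    rw [hu', smul_pow, hv.mul_pow, h7, zero_mul, smul_zero]
  have hdg : di * γ * d = q⁻¹ • γ := by
    have : γ = q • (di * γ * d) := by
      calc γ = di * (d * γ) := by rw [← mul_assoc, hdi', one_mul]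
        _ = _ := by rw [h4, mul_smul_comm, mul_assoc]
    rw [eq_inv_smul_iff₀ hq, ← this]
  have hD : a * d - q⁻¹ • (β * γ) = a * (1 - u) * d := by
    have : a * u * d = q⁻¹ • (β * γ) := by
      calc a * u * d = (a * ai) * β * (di * γ * d) := by rw [hu]; simp only [mul_assoc]
        _ = _ := by rw [hai, one_mul, hdg, mul_smul_comm]
    rw [mul_sub, sub_mul, this, mul_one]
  have hL : d * ai + d * ai * β * di * γ * ai + d * ai * β * di * γ * ai * β * di * γ * ai
      = d * (1 + u + u ^ 2) * ai := by
    rw [hu]; noncomm_ring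
  have hM : d * (1 + u + u ^ 2) * ai * (a * d - q⁻¹ • (β * γ)) = d ^ 2 := by
    calc d * (1 + u + u ^ 2) * ai * (a * d - q⁻¹ • (β * γ))
        = d * (1 + u + u ^ 2) * (ai * a) * (1 - u) * d := by rw [hD]; simp only [mul_assoc]
      _ = d * (1 - u ^ 3) * d := by rw [hai']; noncomm_ring
      _ = d ^ 2 := by rw [hu3, sub_zero, mul_one, sq]
  rw [hL, ← hM, mul_assoc _ _ e₁, he₁, mul_one]
end

section
/- Let A be an associative unital ℂ-algebra, q ∈ ℂ nonzero, and j = e^{2πi/3}. Suppose a, β, γ, d ∈ A satisfy the GL_{q,j}(1|1) relations and a, d are units of A. Define A' = a⁻¹ + a⁻¹βd⁻¹γa⁻¹ + a⁻¹βd⁻¹γa⁻¹βd⁻¹γa⁻¹, B' = −a⁻¹βd⁻¹ − a⁻¹βd⁻¹γa⁻¹βd⁻¹ − a⁻¹βd⁻¹γa⁻¹βd⁻¹γa⁻¹βd⁻¹, C' = −d⁻¹γa⁻¹ − d⁻¹γa⁻¹βd⁻¹γa⁻¹, D' = d⁻¹ + d⁻¹γa⁻¹βd⁻¹ + d⁻¹γa⁻¹βd⁻¹γa⁻¹βd⁻¹.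 Then the matrix [[A', B'], [C', D']] is a two-sided inverse of T = [[a, β], [γ, d]], i.e. both matrix products with T equal the identity matrix. -/
theorem explicit_inverse_matrix
    {A : Type*} [Ring A] [Algebra ℂ A] (q j : ℂ) (hq : q ≠ 0)
    (hj : j = Complex.exp (2 * Real.pi * Complex.I / 3))
    (a β γ d ai di : A)
    (hT : GLRel q j a β γ d)
    (hai : a * ai = 1) (hai' : ai * a = 1)
    (hdi : d * di = 1) (hdi' : di * d = 1) :
    let A' := ai + ai * β * di * γ * ai + ai * β * di * γ * ai * β * di * γ * ai
    let B' := -(ai * β * di) - ai * β * di * γ * ai * β * di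
      - ai * β * di * γ * ai * β * di * γ * ai * β * di
    let C' := -(di * γ * ai) - di * γ * ai * β * di * γ * ai
    let D' := di + di * γ * ai * β * di + di * γ * ai * β * di * γ * ai * β * di
    let T : Matrix (Fin 2) (Fin 2) A := !![a, β; γ, d]
    let M : Matrix (Fin 2) (Fin 2) A := !![A', B'; C', D']
    T * M = 1 ∧ M * T = 1 := by
  obtain ⟨-, -, h3, h4, -, h6, -, h8⟩ := hT
  have inv_comm : ∀ u ui : A, u * γ = q • (γ * u) → u * ui = 1 → ui * u = 1 →
      γ * ui = q • (ui * γ) := by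
    intro u ui h hu hu'
    calc γ * ui = ui * (u * γ) * ui := by rw [← mul_assoc, hu', one_mul]
      _ = q • (ui * γ) := by
        rw [h, mul_smul_comm, smul_mul_assoc]
        simp only [mul_assoc, hu, mul_one]
  have ha := inv_comm a ai h3 hai hai'
  have hd := inv_comm d di h4 hdi hdi'
  have hx : γ * (ai * β * di) = ai * β * di * γ := by
    calc γ * (ai * β * di) = (γ * ai) * β * di := by simp only [mul_assoc]
      _ = q • (ai * (γ * β) * di) := by
        rw [ha]; simp only [smul_mul_assoc, mul_assoc]
      _ = q⁻¹ • (ai * (q ^ 2 • (γ * β)) * di) := by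
        rw [mul_smul_comm, smul_mul_assoc, smul_smul]
        congr 1
        field_simp
      _ = q⁻¹ • (ai * β * (γ * di)) := by
        rw [← h6]; simp only [mul_assoc]
      _ = ai * β * di * γ := by
        rw [hd, mul_smul_comm, smul_smul, inv_mul_cancel₀ hq, one_smul]
        simp only [mul_assoc]
  have key : γ * (ai * β * di) * γ * (ai * β * di) * γ = 0 := by
    generalize ai * β * di = x at hx
    calc γ * x * γ * x * γ = (γ * x) * (γ * x) * γ := by simp only [mul_assoc]
      _ = x * (γ * x) * γ * γ := by
        conv_lhs => rw [hx]
        simp only [mul_assoc]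
      _ = x * x * γ ^ 3 := by rw [hx]; simp only [pow_succ, pow_zero, one_mul, mul_assoc]
      _ = 0 := by rw [h8, mul_zero]
  have key' : ∀ z : A, γ * (ai * (β * (di * (γ * (ai * (β * (di * (γ * z)))))))) = 0 := by
    intro z
    have := congrArg (· * z) key
    simpa only [mul_assoc, zero_mul] using this
  have key0 : γ * (ai * (β * (di * (γ * (ai * (β * (di * γ))))))) = 0 := by
    simpa only [mul_assoc] using key
  have c1 : ∀ z : A, a * (ai * z) = z := fun z => by rw [← mul_assoc, hai, one_mul]
  have c2 : ∀ z : A, d * (di * z) = z := fun z => by rw [← mul_assoc, hdi, one_mul]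
  intro A' B' C' D' T M
  constructor
  · ext i k
    fin_cases i <;> fin_cases k <;>
      simp [T, M, A', B', C', D', Matrix.mul_apply, Fin.sum_univ_two, mul_add, mul_sub,
        mul_assoc, c1, c2, hai, hdi, key', key0] <;> abel
  · ext i k
    fin_cases i <;> fin_cases k <;>
      simp [T, M, A', B', C', D', Matrix.mul_apply, Fin.sum_univ_two, add_mul, sub_mul,
        mul_assoc, hai', hdi', key', key0] <;> abel
end

section
/- Let A be an associative unital ℂ-algebra, q ∈ ℂ nonzero, and j = e^{2πi/3}. Suppose a, β, γ, d ∈ A satisfy the GL_{q,j}(1|1) relations and a, d are units of A. Define A' = a⁻¹ + a⁻¹βd⁻¹γa⁻¹ + a⁻¹βd⁻¹γa⁻¹βd⁻¹γa⁻¹, B' = −a⁻¹βd⁻¹ − a⁻¹βd⁻¹γa⁻¹βd⁻¹ − a⁻¹βd⁻¹γa⁻¹βd⁻¹γa⁻¹βd⁻¹, C' = −d⁻¹γa⁻¹ − d⁻¹γa⁻¹βd⁻¹γa⁻¹, D' = d⁻¹ + d⁻¹γa⁻¹βd⁻¹ + d⁻¹γa⁻¹βd⁻¹γa⁻¹βd⁻¹.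 Then A', B', C', D' satisfy the GL_{q⁻¹,j⁻¹}(1|1) relations: A'B' = q j B'A', D'B' = q j² B'D', A'C' = q⁻¹ C'A', D'C' = q⁻¹ C'D', A'D' = D'A' + q(1 − j²) B'C', B'C' = q⁻² C'B', B'³ = 0, and C'³ = 0. -/
set_option linter.unusedSimpArgs false

/-- If `x * y = w`, the same rewrite holds inside a longer right-associated word. -/
theorem word_rule {A : Type*} [Ring A] {x y w : A} (h : x * y = w) (z : A) :
    x * (y * z) = w * z := by rw [← mul_assoc, h]

/-- Moving an inverse past an element that `q`-commutes. -/
theorem inv_comm_rule {A : Type*} [Ring A] [Algebra ℂ A] {s s' : ℂ} (hs : s' * s = 1)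
    {a ai b : A} (h : a * b = s • (b * a)) (h1 : a * ai = 1) (h2 : ai * a = 1) :
    ai * b = s' • (b * ai) := by
  have : ai * (a * b) * ai = ai * (s • (b * a)) * ai := by rw [h]
  have e1 : ai * (a * b) * ai = b * ai := by rw [← mul_assoc ai, h2, one_mul]
  have e2 : ai * (s • (b * a)) * ai = s • (ai * b) := by
    rw [mul_smul_comm, smul_mul_assoc, mul_assoc, mul_assoc, h1, mul_one]
  rw [e1, e2] at this
  rw [this, smul_smul, hs, one_smul]

set_option maxHeartbeats 4000000 in
theorem inverse_matrix_satisfies_inverse_GL_relations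
    {A : Type*} [Ring A] [Algebra ℂ A] (q j : ℂ) (hq : q ≠ 0)
    (hj : j = Complex.exp (2 * Real.pi * Complex.I / 3))
    (a β γ d ai di : A)
    (hT : GLRel q j a β γ d)
    (hai : a * ai = 1) (hai' : ai * a = 1)
    (hdi : d * di = 1) (hdi' : di * d = 1) :
    let A' := ai + ai * β * di * γ * ai + ai * β * di * γ * ai * β * di * γ * ai
    let B' := -(ai * β * di) - ai * β * di * γ * ai * β * di
      - ai * β * di * γ * ai * β * di * γ * ai * β * di
    let C' := -(di * γ * ai) - di * γ * ai * β * di * γ * ai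
    let D' := di + di * γ * ai * β * di + di * γ * ai * β * di * γ * ai * β * di
    A' * B' = (q * j) • (B' * A') ∧
    D' * B' = (q * j ^ 2) • (B' * D') ∧
    A' * C' = q⁻¹ • (C' * A') ∧
    D' * C' = q⁻¹ • (C' * D') ∧
    A' * D' = D' * A' + (q * (1 - j ^ 2)) • (B' * C') ∧
    B' * C' = (q ^ (-2 : ℤ)) • (C' * B') ∧
    B' ^ 3 = 0 ∧ C' ^ 3 = 0 := by
  have hj2 : j ^ 2 = - 1 - j := by
    have hp : IsPrimitiveRoot j 3 := by
      rw [hj]; exact_mod_cast Complex.isPrimitiveRoot_exp 3 (by norm_num)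
    have := hp.geom_sum_eq_zero (by norm_num)
    simp only [Finset.sum_range_succ, Finset.sum_range_zero] at this
    linear_combination this
  clear hj
  have hj3 : j * j ^ 2 = 1 := by
    rw [hj2]; linear_combination (-1 : ℂ) * hj2
  have hji : j⁻¹ = j ^ 2 := inv_eq_of_mul_eq_one_right hj3
  obtain ⟨h1, h2, h3, h4, h5, h6, h7, h8⟩ := hT
  rw [zpow_neg, zpow_ofNat]
  rw [← inv_pow]
  rw [hji] at h1
  obtain ⟨r, hr⟩ : ∃ r, r = q⁻¹ := ⟨_, rfl⟩
  have hqr : q * r = 1 := by rw [hr]; exact mul_inv_cancel₀ hq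
  rw [← hr] at h1 h2 h5 ⊢
  clear hr hji hq
  have b3 : β * (β * β) = 0 := by rw [← h7]; noncomm_ring
  have g3 : γ * (γ * γ) = 0 := by rw [← h8]; noncomm_ring
  have b3' : ∀ w, β * (β * (β * w)) = 0 := fun w => by
    rw [← mul_assoc β β w, ← mul_assoc β _ w, b3, zero_mul]
  have g3' : ∀ w, γ * (γ * (γ * w)) = 0 := fun w => by
    rw [← mul_assoc γ γ w, ← mul_assoc γ _ w, g3, zero_mul]
  have gb : γ * β = (r ^ 2) • (β * γ) := by
    rw [h6, smul_smul, ← mul_pow, mul_comm r, hqr, one_pow, one_smul]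
  have aib := inv_comm_rule (s' := q * j) (by grind) h1 hai hai'
  have dib := inv_comm_rule (s' := q * j ^ 2) (by grind) h2 hdi hdi'
  have aig := inv_comm_rule (s' := r) (by grind) h3 hai hai'
  have dig := inv_comm_rule (s' := r) (by grind) h4 hdi hdi'
  have aid0 : ai * d = d * ai - (r * (1 - j) * j) • (β * (γ * (ai * ai))) := by
    have e : ai * (a * d) * ai = ai * (d * a + (r * (1 - j)) • (β * γ)) * ai := by rw [h5]
    have e1 : ai * (a * d) * ai = d * ai := by rw [← mul_assoc ai, hai', one_mul]
    have e2 : ai * (d * a + (r * (1 - j)) • (β * γ)) * ai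
        = ai * d + (r * (1 - j) * j) • (β * (γ * (ai * ai))) := by
      simp only [mul_add, add_mul, mul_smul_comm, smul_mul_assoc, mul_assoc, hai, mul_one,
        aib, word_rule aib, aig, word_rule aig, smul_smul]
      congr 2
      grind
    rw [e1, e2] at e
    rw [e]; abel
  have aib' := word_rule aib
  have dib' := word_rule dib
  have aig' := word_rule aig
  have dig' := word_rule dig
  have gb' := word_rule gb
  obtain ⟨t, ht⟩ : ∃ t, t = β * (γ * (di * ai)) := ⟨_, rfl⟩
  have bt : β * t = t * β := by
    rw [ht]
    simp only [mul_assoc, mul_smul_comm, smul_mul_assoc, smul_smul, mul_zero, smul_zero,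
      gb, gb', b3, b3', g3, g3', aib, aib', aig, aig', dib, dib', dig, dig']
    match_scalars <;> grind
  have gt : γ * t = t * γ := by
    rw [ht]
    simp only [mul_assoc, mul_smul_comm, smul_mul_assoc, smul_smul, mul_zero, smul_zero,
      gb, gb', b3, b3', g3, g3', aib, aib', aig, aig', dib, dib', dig, dig']
    match_scalars <;> grind
  have bt' := word_rule bt
  have gt' := word_rule gt
  have btt : β * (t * t) = 0 := by
    nth_rewrite 1 [ht]
    rw [ht]
    simp only [mul_assoc, mul_smul_comm, smul_mul_assoc, smul_smul, mul_zero, smul_zero,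
      gb, gb', b3, b3', g3, g3', aib, aib', aig, aig', dib, dib', dig, dig']
  have gtt : γ * (t * t) = 0 := by
    nth_rewrite 1 [ht]
    rw [ht]
    simp only [mul_assoc, mul_smul_comm, smul_mul_assoc, smul_smul, mul_zero, smul_zero,
      gb, gb', b3, b3', g3, g3', aib, aib', aig, aig', dib, dib', dig, dig']
  have ttb : t * (t * β) = 0 := by
    rw [← bt, ← mul_assoc, ← bt, mul_assoc, btt]
  have ttg : t * (t * γ) = 0 := by
    rw [← gt, ← mul_assoc, ← gt, mul_assoc, gtt]
  have tbb : t * (β * β) = 0 := by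
    rw [← mul_assoc, ← bt, mul_assoc, ← bt, ht, b3']
  have tgg : t * (γ * γ) = 0 := by
    rw [← mul_assoc, ← gt, mul_assoc, ← gt, ht]
    simp only [mul_assoc, mul_smul_comm, smul_mul_assoc, smul_smul, mul_zero, smul_zero,
      gb, gb', b3, b3', g3, g3', aib, aib', aig, aig', dib, dib', dig, dig']
  have zero3 : ∀ {x y z : A}, x * (y * z) = 0 → ∀ w, x * (y * (z * w)) = 0 := by
    intro x y z h w
    rw [← mul_assoc y, ← mul_assoc, h, zero_mul]
  have ttb' := zero3 ttb
  have ttg' := zero3 ttg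
  have tbb' := zero3 tbb
  have tgg' := zero3 tgg
  have ttt : t * (t * t) = 0 := by
    nth_rewrite 3 [ht]
    rw [ttb']
  have ttt' := zero3 ttt
  have aid1 : ai * di = di * ai + (r * (1 - j)) • (t * (ai * di)) := by
    have e : di * (ai * d) * di
      = di * (d * ai - (r * (1 - j) * j) • (β * (γ * (ai * ai)))) * di := by rw [aid0]
    have e1 : di * (ai * d) * di = di * ai := by
      rw [mul_assoc, mul_assoc, hdi, mul_one]
    have e2 : di * (d * ai - (r * (1 - j) * j) • (β * (γ * (ai * ai)))) * di
        = ai * di - (r * (1 - j)) • (t * (ai * di)) := by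
      rw [ht]
      simp only [mul_sub, sub_mul, word_rule hdi', one_mul, mul_assoc, mul_smul_comm, smul_mul_assoc, smul_smul, mul_zero, smul_zero,
      gb, gb', b3, b3', g3, g3', aib, aib', aig, aig', dib, dib', dig, dig']
      congr 2
      grind
    rw [e1, e2] at e
    rw [e]; abel
  have aid : ai * di = di * ai + (r * (1 - j)) • (t * (di * ai))
      + (r * (1 - j)) ^ 2 • (t * (t * (di * ai))) := by
    rw [aid1, aid1, aid1]
    simp only [mul_add, mul_smul_comm, ttt', smul_zero, smul_add, smul_smul, add_zero]
    module
  have aid' := word_rule aid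
  have bgda : β * (γ * (di * ai)) = t := ht.symm
  have bgda' := fun w => by
    have := congrArg (· * w) bgda
    simpa only [mul_assoc] using this
  have ait : ai * t = j • (t * ai) + (j * (r * (1 - j))) • (t * (t * ai)) := by
    nth_rewrite 1 [ht]
    simp only [add_mul, mul_add, smul_add, aid', bt', gt', bgda', ttt', mul_assoc, mul_smul_comm, smul_mul_assoc, smul_smul, mul_zero, smul_zero,
      gb, gb', b3, b3', g3, g3', aib, aib', aig, aig', dib, dib', dig, dig', add_zero]
    match_scalars <;> grind
  have dit : di * t = (j ^ 2) • (t * di) - (j * (r * (1 - j))) • (t * (t * di)) := by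
    have e0 : t * (di * ai) = di * (ai * t) := by
      rw [ht]
      simp only [mul_assoc, mul_smul_comm, smul_mul_assoc, smul_smul, mul_zero, smul_zero,
      gb, gb', b3, b3', g3, g3', aib, aib', aig, aig', dib, dib', dig, dig']
      match_scalars <;> grind
    have e1 : t * di = j • (di * t) + (j * (r * (1 - j))) • (di * (t * t)) := by
      have := congrArg (· * a) e0
      simp only [ait, mul_add, add_mul, mul_assoc, mul_smul_comm, smul_mul_assoc, smul_smul, mul_zero, smul_zero,
      gb, gb', b3, b3', g3, g3', aib, aib', aig, aig', dib, dib', dig, dig', hai', mul_one] at this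
      exact this
    have e2 : t * (di * t) = j • (di * (t * t)) := by
      have := congrArg (· * t) e1
      simpa only [add_mul, smul_mul_assoc, mul_assoc, ttt, mul_zero, smul_zero, add_zero]
        using this
    have e3 : t * (di * (t * t)) = 0 := by
      have := congrArg (· * t) e2
      simpa only [add_mul, smul_mul_assoc, mul_assoc, ttt, mul_zero, smul_zero, add_zero]
        using this
    have e4 : t * (t * di) = (j ^ 2) • (di * (t * t)) := by
      rw [e1, mul_add, mul_smul_comm, mul_smul_comm, e3, e2, smul_zero, add_zero, smul_smul, pow_two]
    rw [e4, e1]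
    match_scalars <;> grind
  have ait' := word_rule ait
  have dit' := word_rule dit
  have bgdda : ∀ w, β * (γ * (di * (di * (ai * w)))) =
      t * (di * w) - (j ^ 2 * (r * (1 - j))) • (t * (t * (di * w))) := by
    intro w
    have e : β * (γ * (di * (di * (ai * w)))) = j • (di * (t * w)) := by
      rw [ht]
      simp only [mul_assoc, mul_smul_comm, smul_mul_assoc, smul_smul, mul_zero, smul_zero,
      gb, gb', b3, b3', g3, g3', aib, aib', aig, aig', dib, dib', dig, dig']
      match_scalars <;> grind
    rw [e, dit']
    simp only [sub_mul, smul_mul_assoc, mul_assoc]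
    match_scalars <;> grind
  clear h1 h2 h3 h4 h5 h6 h7 h8 aid0 aid1 hai hai' hdi hdi' bgda
  intro A' B' C' D'
  have bgda : β * (γ * (di * ai)) = t := ht.symm
  clear ht
  have hA : A' = ai + (r * j) • (t * ai) + (j * r ^ 2) • (t * (t * ai)) := by
    simp only [A', mul_add, add_mul, mul_sub, sub_mul, mul_neg, neg_mul, mul_smul_comm, smul_mul_assoc,
        mul_assoc, gb, gb', b3, b3', g3, g3', aib, aib', aig, aig', dib, dib', dig, dig', aid, aid',
        bt, bt', gt, gt', ttb, ttb', ttg, ttg', tbb, tbb', tgg, tgg', ttt, ttt', ait, ait', dit, dit',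
        bgda, bgda', bgdda,
        smul_smul, mul_zero, zero_mul, smul_zero, smul_add, smul_sub, smul_neg, add_zero, zero_add,
        sub_zero, neg_zero]
    match_scalars <;> grind
  have hB : B' = -((q * j) • (β * (di * ai))) - j • (t * (β * (di * ai))) := by
    simp only [B', mul_add, add_mul, mul_sub, sub_mul, mul_neg, neg_mul, mul_smul_comm, smul_mul_assoc,
        mul_assoc, gb, gb', b3, b3', g3, g3', aib, aib', aig, aig', dib, dib', dig, dig', aid, aid',
        bt, bt', gt, gt', ttb, ttb', ttg, ttg', tbb, tbb', tgg, tgg', ttt, ttt', ait, ait', dit, dit',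
        bgda, bgda', bgdda,
        smul_smul, mul_zero, zero_mul, smul_zero, smul_add, smul_sub, smul_neg, add_zero, zero_add,
        sub_zero, neg_zero]
    match_scalars <;> grind
  have hC : C' = -(r • (γ * (di * ai))) - (r ^ 2) • (t * (γ * (di * ai))) := by
    simp only [C', mul_add, add_mul, mul_sub, sub_mul, mul_neg, neg_mul, mul_smul_comm, smul_mul_assoc,
        mul_assoc, gb, gb', b3, b3', g3, g3', aib, aib', aig, aig', dib, dib', dig, dig', aid, aid',
        bt, bt', gt, gt', ttb, ttb', ttg, ttg', tbb, tbb', tgg, tgg', ttt, ttt', ait, ait', dit, dit',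
        bgda, bgda', bgdda,
        smul_smul, mul_zero, zero_mul, smul_zero, smul_add, smul_sub, smul_neg, add_zero, zero_add,
        sub_zero, neg_zero]
    match_scalars <;> grind
  have hD : D' = di + r • (t * di) + (r ^ 2) • (t * (t * di)) := by
    simp only [D', mul_add, add_mul, mul_sub, sub_mul, mul_neg, neg_mul, mul_smul_comm, smul_mul_assoc,
        mul_assoc, gb, gb', b3, b3', g3, g3', aib, aib', aig, aig', dib, dib', dig, dig', aid, aid',
        bt, bt', gt, gt', ttb, ttb', ttg, ttg', tbb, tbb', tgg, tgg', ttt, ttt', ait, ait', dit, dit',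
        bgda, bgda', bgdda,
        smul_smul, mul_zero, zero_mul, smul_zero, smul_add, smul_sub, smul_neg, add_zero, zero_add,
        sub_zero, neg_zero]
    match_scalars <;> grind
  clear_value A' B' C' D'
  subst hA hB hC hD
  refine ⟨?_, ?_, ?_, ?_, ?_, ?_, ?_, ?_⟩
  · simp only [mul_add, add_mul, mul_sub, sub_mul, mul_neg, neg_mul, mul_smul_comm, smul_mul_assoc,
        mul_assoc, gb, gb', b3, b3', g3, g3', aib, aib', aig, aig', dib, dib', dig, dig', aid, aid',
        bt, bt', gt, gt', ttb, ttb', ttg, ttg', tbb, tbb', tgg, tgg', ttt, ttt', ait, ait', dit, dit',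
        bgda, bgda', bgdda,
        smul_smul, mul_zero, zero_mul, smul_zero, smul_add, smul_sub, smul_neg, add_zero, zero_add,
        sub_zero, neg_zero]
    match_scalars <;> grind
  · simp only [mul_add, add_mul, mul_sub, sub_mul, mul_neg, neg_mul, mul_smul_comm, smul_mul_assoc,
        mul_assoc, gb, gb', b3, b3', g3, g3', aib, aib', aig, aig', dib, dib', dig, dig', aid, aid',
        bt, bt', gt, gt', ttb, ttb', ttg, ttg', tbb, tbb', tgg, tgg', ttt, ttt', ait, ait', dit, dit',
        bgda, bgda', bgdda,
        smul_smul, mul_zero, zero_mul, smul_zero, smul_add, smul_sub, smul_neg, add_zero, zero_add,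
        sub_zero, neg_zero]
    match_scalars <;> grind
  · simp only [mul_add, add_mul, mul_sub, sub_mul, mul_neg, neg_mul, mul_smul_comm, smul_mul_assoc,
        mul_assoc, gb, gb', b3, b3', g3, g3', aib, aib', aig, aig', dib, dib', dig, dig', aid, aid',
        bt, bt', gt, gt', ttb, ttb', ttg, ttg', tbb, tbb', tgg, tgg', ttt, ttt', ait, ait', dit, dit',
        bgda, bgda', bgdda,
        smul_smul, mul_zero, zero_mul, smul_zero, smul_add, smul_sub, smul_neg, add_zero, zero_add,
        sub_zero, neg_zero]
    match_scalars <;> grind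
  · simp only [mul_add, add_mul, mul_sub, sub_mul, mul_neg, neg_mul, mul_smul_comm, smul_mul_assoc,
        mul_assoc, gb, gb', b3, b3', g3, g3', aib, aib', aig, aig', dib, dib', dig, dig', aid, aid',
        bt, bt', gt, gt', ttb, ttb', ttg, ttg', tbb, tbb', tgg, tgg', ttt, ttt', ait, ait', dit, dit',
        bgda, bgda', bgdda,
        smul_smul, mul_zero, zero_mul, smul_zero, smul_add, smul_sub, smul_neg, add_zero, zero_add,
        sub_zero, neg_zero]
    match_scalars <;> grind
  · simp only [mul_add, add_mul, mul_sub, sub_mul, mul_neg, neg_mul, mul_smul_comm, smul_mul_assoc,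
        mul_assoc, gb, gb', b3, b3', g3, g3', aib, aib', aig, aig', dib, dib', dig, dig', aid, aid',
        bt, bt', gt, gt', ttb, ttb', ttg, ttg', tbb, tbb', tgg, tgg', ttt, ttt', ait, ait', dit, dit',
        bgda, bgda', bgdda,
        smul_smul, mul_zero, zero_mul, smul_zero, smul_add, smul_sub, smul_neg, add_zero, zero_add,
        sub_zero, neg_zero]
    match_scalars <;> grind
  · simp only [mul_add, add_mul, mul_sub, sub_mul, mul_neg, neg_mul, mul_smul_comm, smul_mul_assoc,
        mul_assoc, gb, gb', b3, b3', g3, g3', aib, aib', aig, aig', dib, dib', dig, dig', aid, aid',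
        bt, bt', gt, gt', ttb, ttb', ttg, ttg', tbb, tbb', tgg, tgg', ttt, ttt', ait, ait', dit, dit',
        bgda, bgda', bgdda,
        smul_smul, mul_zero, zero_mul, smul_zero, smul_add, smul_sub, smul_neg, add_zero, zero_add,
        sub_zero, neg_zero]
    match_scalars <;> grind
  · simp only [pow_succ, pow_zero, one_mul, mul_add, add_mul, mul_sub, sub_mul, mul_neg, neg_mul, mul_smul_comm, smul_mul_assoc,
        mul_assoc, gb, gb', b3, b3', g3, g3', aib, aib', aig, aig', dib, dib', dig, dig', aid, aid',
        bt, bt', gt, gt', ttb, ttb', ttg, ttg', tbb, tbb', tgg, tgg', ttt, ttt', ait, ait', dit, dit',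
        bgda, bgda', bgdda,
        smul_smul, mul_zero, zero_mul, smul_zero, smul_add, smul_sub, smul_neg, add_zero, zero_add,
        sub_zero, neg_zero]
  · simp only [pow_succ, pow_zero, one_mul, mul_add, add_mul, mul_sub, sub_mul, mul_neg, neg_mul, mul_smul_comm, smul_mul_assoc,
        mul_assoc, gb, gb', b3, b3', g3, g3', aib, aib', aig, aig', dib, dib', dig, dig', aid, aid',
        bt, bt', gt, gt', ttb, ttb', ttg, ttg', tbb, tbb', tgg, tgg', ttt, ttt', ait, ait', dit, dit',
        bgda, bgda', bgdda,
        smul_smul, mul_zero, zero_mul, smul_zero, smul_add, smul_sub, smul_neg, add_zero, zero_add,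
        sub_zero, neg_zero]
end

section
/- Let A be an associative unital ℂ-algebra, q ∈ ℂ nonzero, and j = e^{2πi/3}. Suppose a, β, γ, d ∈ A satisfy the GL_{q,j}(1|1) relations and a, d are units of A. Define A' = a⁻¹ + a⁻¹βd⁻¹γa⁻¹ + a⁻¹βd⁻¹γa⁻¹βd⁻¹γa⁻¹, B' = −a⁻¹βd⁻¹ − a⁻¹βd⁻¹γa⁻¹βd⁻¹ − a⁻¹βd⁻¹γa⁻¹βd⁻¹γa⁻¹βd⁻¹, C' = −d⁻¹γa⁻¹ − d⁻¹γa⁻¹βd⁻¹γa⁻¹, D' = d⁻¹ + d⁻¹γa⁻¹βd⁻¹ + d⁻¹γa⁻¹βd⁻¹γa⁻¹βd⁻¹. Then the following cross-commutation relations hold: aA' = j²A'a + (1−j²)·1, aB' = q⁻¹j²B'a, aC' = qC'a, aD' = D'a, βA' = q⁻¹j²A'β, βB' = q⁻²B'β, βC' = C'β, βD' = q⁻¹jD'β, γA' = qA'γ, γB' = B'γ, γC' = q²C'γ, γD' = qD'γ, dA' = A'd, dB' = q⁻¹jB'd, dC' = qC'd, and dD' = jD'd + (1−j)·1. -/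
theorem assoc_aux {A : Type*} [Ring A] {x y z : A} (h : x * y = z) (w : A) :
    x * (y * w) = z * w := by rw [← mul_assoc, h]

theorem inv_swap_aux {A : Type*} [Ring A] [Algebra ℂ A] {c c' : ℂ} (hc : c' * c = 1)
    {a ai b : A} (h1 : a * ai = 1) (h2 : ai * a = 1) (h : a * b = c • (b * a)) :
    ai * b = c' • (b * ai) := by
  have e : b * ai = c • (ai * b) := by
    calc b * ai = ai * (a * b) * ai := by rw [← mul_assoc ai, h2, one_mul]
      _ = c • (ai * b) := by
        rw [h, mul_smul_comm, smul_mul_assoc, mul_assoc, mul_assoc, h1, mul_one]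
  rw [e, smul_smul, hc, one_smul]

theorem j_rel_aux (j : ℂ) (hj : j = Complex.exp (2 * Real.pi * Complex.I / 3)) :
    j ^ 2 + j + 1 = 0 := by
  have h := (Complex.isPrimitiveRoot_exp 3 (by norm_num)).geom_sum_eq_zero (by norm_num)
  simp only [Finset.sum_range_succ, Finset.sum_range_zero] at h
  push_cast at h
  rw [← hj] at h
  linear_combination h

set_option linter.unusedSimpArgs false
set_option maxRecDepth 10000
set_option maxHeartbeats 4000000

theorem cross_commutation_relations_with_inverse_entries
    {A : Type*} [Ring A] [Algebra ℂ A] (q j : ℂ) (hq : q ≠ 0)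
    (hj : j = Complex.exp (2 * Real.pi * Complex.I / 3))
    (a β γ d ai di : A)
    (hT : GLRel q j a β γ d)
    (hai : a * ai = 1) (hai' : ai * a = 1)
    (hdi : d * di = 1) (hdi' : di * d = 1) :
    let A' := ai + ai * β * di * γ * ai + ai * β * di * γ * ai * β * di * γ * ai
    let B' := -(ai * β * di) - ai * β * di * γ * ai * β * di
      - ai * β * di * γ * ai * β * di * γ * ai * β * di
    let C' := -(di * γ * ai) - di * γ * ai * β * di * γ * ai
    let D' := di + di * γ * ai * β * di + di * γ * ai * β * di * γ * ai * β * di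
    a * A' = (j ^ 2) • (A' * a) + (1 - j ^ 2) • (1 : A) ∧
    a * B' = (q⁻¹ * j ^ 2) • (B' * a) ∧
    a * C' = q • (C' * a) ∧
    a * D' = D' * a ∧
    β * A' = (q⁻¹ * j ^ 2) • (A' * β) ∧
    β * B' = (q ^ (-2 : ℤ)) • (B' * β) ∧
    β * C' = C' * β ∧
    β * D' = (q⁻¹ * j) • (D' * β) ∧
    γ * A' = q • (A' * γ) ∧
    γ * B' = B' * γ ∧
    γ * C' = (q ^ 2) • (C' * γ) ∧
    γ * D' = q • (D' * γ) ∧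
    d * A' = A' * d ∧
    d * B' = (q⁻¹ * j) • (B' * d) ∧
    d * C' = q • (C' * d) ∧
    d * D' = j • (D' * d) + (1 - j) • (1 : A) := by
  have hj2 : j ^ 2 + j + 1 = 0 := j_rel_aux j hj
  have hj3 : j ^ 3 = 1 := by linear_combination (j - 1) * hj2
  have hji : j⁻¹ = j ^ 2 := inv_eq_of_mul_eq_one_right (by linear_combination hj3)
  obtain ⟨p, hp⟩ : ∃ p, p = q⁻¹ := ⟨_, rfl⟩
  have hpq : p * q = 1 := by rw [hp]; exact inv_mul_cancel₀ hq
  have hz : q ^ (-2 : ℤ) = p ^ 2 := by rw [hp]; simp [zpow_neg]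
  obtain ⟨ab, db, ag, dg, ad, bg, b3, g3⟩ := hT
  rw [hz]
  rw [← hp] at *
  clear hz hj hp
  rw [hji] at ab
  clear hji
  have xb : ai * β = (q * j) • (β * ai) :=
    inv_swap_aux (by linear_combination j ^ 3 * hpq + hj3) hai hai' ab
  have yb : di * β = (q * j ^ 2) • (β * di) :=
    inv_swap_aux (by linear_combination j ^ 3 * hpq + hj3) hdi hdi' db
  have xg : ai * γ = p • (γ * ai) := inv_swap_aux hpq hai hai' ag
  have yg : di * γ = p • (γ * di) := inv_swap_aux hpq hdi hdi' dg
  have gb : γ * β = (p ^ 2) • (β * γ) := by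
    rw [bg, smul_smul, ← mul_pow, hpq, one_pow, one_smul]
  have bbb : β * (β * β) = 0 := by rw [← b3]; noncomm_ring
  have ggg : γ * (γ * γ) = 0 := by rw [← g3]; noncomm_ring
  have bbb' : ∀ w, β * (β * (β * w)) = 0 := fun w => by
    rw [← mul_assoc β β w, ← mul_assoc β (β * β) w, bbb, zero_mul]
  have ggg' : ∀ w, γ * (γ * (γ * w)) = 0 := fun w => by
    rw [← mul_assoc γ γ w, ← mul_assoc γ (γ * γ) w, ggg, zero_mul]
  clear b3 g3 bg
  -- work with `u = di * ai` and its inverse `v = a * d`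
  obtain ⟨u, hu⟩ : ∃ u, u = di * ai := ⟨_, rfl⟩
  obtain ⟨v, hv⟩ : ∃ v, v = a * d := ⟨_, rfl⟩
  have uv : u * v = 1 := by rw [hu, hv, mul_assoc, assoc_aux hai', one_mul, hdi']
  have vu : v * u = 1 := by rw [hu, hv, mul_assoc, assoc_aux hdi, one_mul, hai]
  have hy : di = u * a := by rw [hu, mul_assoc, hai', mul_one]
  have hda : d * a = v - (p * (1 - j)) • (β * γ) := by rw [hv, ad]; abel
  have hd : d = (v - (p * (1 - j)) • (β * γ)) * ai := by rw [← hda, mul_assoc, hai, mul_one]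
  have ub : u * β = (q ^ 2) • (β * u) := by
    rw [hu]
    simp only [mul_assoc, xb, mul_smul_comm, assoc_aux yb, smul_mul_assoc, smul_smul]
    match_scalars; grind
  have ug : u * γ = (p ^ 2) • (γ * u) := by
    rw [hu]
    simp only [mul_assoc, xg, mul_smul_comm, assoc_aux yg, smul_mul_assoc, smul_smul]
    match_scalars; grind
  have vb : v * β = (p ^ 2) • (β * v) := by
    rw [hv]
    simp only [mul_assoc, db, mul_smul_comm, assoc_aux ab, smul_mul_assoc, smul_smul]
    match_scalars; grind
  have vg : v * γ = (q ^ 2) • (γ * v) := by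
    rw [hv]
    simp only [mul_assoc, dg, mul_smul_comm, assoc_aux ag, smul_mul_assoc, smul_smul]
    match_scalars; grind
  have xv : ai * v = (v - (p * (1 - j)) • (β * γ)) * ai := by
    rw [← hd, hv, assoc_aux hai', one_mul]
  have av : a * v = (v + (p * (1 - j) * j ^ 2) • (β * γ)) * a := by
    have e : v = d * a + (p * (1 - j)) • (β * γ) := by rw [hda]; abel
    rw [add_mul]
    nth_rewrite 1 [e]
    rw [mul_add, ← mul_assoc a d a, ← hv]
    simp only [mul_assoc, ag, mul_smul_comm, assoc_aux ab, smul_mul_assoc, smul_smul]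
    match_scalars <;> grind
  clear db dg yb yg hda ad
  obtain ⟨T, hT⟩ : ∃ T, T = u + (p * (1 - j)) • (β * (γ * (u * u)))
      + ((p * (1 - j)) ^ 2 * p ^ 2) • (β * (β * (γ * (γ * (u * (u * u)))))) := ⟨_, rfl⟩
  obtain ⟨V, hV⟩ : ∃ V, V = u - (p * (1 - j) * j ^ 2) • (β * (γ * (u * u)))
      + ((p * (1 - j)) ^ 2 * j * p ^ 2) • (β * (β * (γ * (γ * (u * (u * u)))))) := ⟨_, rfl⟩
  have T1 : T * (v - (p * (1 - j)) • (β * γ)) = 1 := by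
    rw [hT]
    simp only [mul_assoc, smul_mul_assoc, mul_smul_comm, smul_smul, mul_add, add_mul, mul_sub,
    sub_mul, neg_mul, mul_neg, smul_add, smul_sub, smul_neg, mul_zero, zero_mul, smul_zero,
    mul_one, one_mul, add_zero, zero_add, sub_zero, neg_zero,
    hai, hai', uv, vu, ab, ag, xb, xg, gb, bbb, ggg, ub, ug, vb, vg,
    assoc_aux hai, assoc_aux hai', assoc_aux uv, assoc_aux vu, assoc_aux ab, assoc_aux ag,
    assoc_aux xb, assoc_aux xg, assoc_aux ub, assoc_aux ug, assoc_aux vb, assoc_aux vg,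
    assoc_aux gb, bbb', ggg']
    match_scalars <;> grind
  have V1 : V * (v + (p * (1 - j) * j ^ 2) • (β * γ)) = 1 := by
    rw [hV]
    simp only [mul_assoc, smul_mul_assoc, mul_smul_comm, smul_smul, mul_add, add_mul, mul_sub,
    sub_mul, neg_mul, mul_neg, smul_add, smul_sub, smul_neg, mul_zero, zero_mul, smul_zero,
    mul_one, one_mul, add_zero, zero_add, sub_zero, neg_zero,
    hai, hai', uv, vu, ab, ag, xb, xg, gb, bbb, ggg, ub, ug, vb, vg,
    assoc_aux hai, assoc_aux hai', assoc_aux uv, assoc_aux vu, assoc_aux ab, assoc_aux ag,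
    assoc_aux xb, assoc_aux xg, assoc_aux ub, assoc_aux ug, assoc_aux vb, assoc_aux vg,
    assoc_aux gb, bbb', ggg']
    match_scalars <;> grind
  have xu : ai * u = T * ai := by
    calc ai * u = T * (v - (p * (1 - j)) • (β * γ)) * (ai * u) := by rw [T1, one_mul]
      _ = T * ai := by rw [mul_assoc, ← mul_assoc _ ai u, ← xv, mul_assoc, vu, mul_one]
  have au : a * u = V * a := by
    calc a * u = V * (v + (p * (1 - j) * j ^ 2) • (β * γ)) * (a * u) := by rw [V1, one_mul]
      _ = V * a := by rw [mul_assoc, ← mul_assoc _ a u, ← av, mul_assoc, vu, mul_one]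
  rw [hT] at xu
  rw [hV] at au
  clear hT hV T1 V1 T V hdi hdi' hu hv
  intro A' B' C' D'
  simp only [A', B', C', D']
  clear A' B' C' D'
  subst hy hd
  refine ⟨?_, ?_, ?_, ?_, ?_, ?_, ?_, ?_, ?_, ?_, ?_, ?_, ?_, ?_, ?_, ?_⟩
  all_goals
    simp only [mul_assoc, smul_mul_assoc, mul_smul_comm, smul_smul, mul_add, add_mul, mul_sub,
    sub_mul, neg_mul, mul_neg, smul_add, smul_sub, smul_neg, mul_zero, zero_mul, smul_zero,
    mul_one, one_mul, add_zero, zero_add, sub_zero, neg_zero,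
    hai, hai', uv, vu, ab, ag, xb, xg, gb, bbb, ggg, ub, ug, vb, vg,
    assoc_aux hai, assoc_aux hai', assoc_aux uv, assoc_aux vu, assoc_aux ab, assoc_aux ag,
    assoc_aux xb, assoc_aux xg, assoc_aux ub, assoc_aux ug, assoc_aux vb, assoc_aux vg,
    assoc_aux gb, bbb', ggg',
      xu, xv, au, av, assoc_aux xu, assoc_aux xv, assoc_aux au, assoc_aux av]
  all_goals match_scalars <;> grind
end

section
/- Let A be an associative unital ℂ-algebra, q ∈ ℂ nonzero, and j = e^{2πi/3}. Suppose a₁, β₁, γ₁, d₁ ∈ A and a₂, β₂, γ₂, d₂ ∈ A each satisfy the GL_{q,j}(1|1) relations, that a₁, d₁ commute with all of a₂, β₂, γ₂, d₂ and a₂, d₂ commute with all of a₁, β₁, γ₁, d₁, and that the cross relations β₁γ₂ = jγ₂β₁, β₁β₂ = j²β₂β₁, γ₁β₂ = jβ₂γ₁, γ₁γ₂ = j²γ₂γ₁ hold. Then the entries of the matrix product, namely a = a₁a₂ + β₁γ₂, β = a₁β₂ + β₁d₂, γ = γ₁a₂ + d₁γ₂, d = γ₁β₂ + d₁d₂, again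 satisfy the GL_{q,j}(1|1) relations. -/
set_option linter.unusedSimpArgs false
theorem assoc_smul {A : Type*} [Ring A] [Algebra ℂ A] {x y u v : A} {c : ℂ}
    (h : x * y = c • (u * v)) (z : A) : x * (y * z) = c • (u * (v * z)) := by
  rw [← mul_assoc, h, smul_mul_assoc, mul_assoc]

theorem assoc_comm {A : Type*} [Ring A] {x y : A}
    (h : x * y = y * x) (z : A) : x * (y * z) = y * (x * z) := by
  rw [← mul_assoc, h, mul_assoc]

theorem assoc_add {A : Type*} [Ring A] [Algebra ℂ A] {x y u v : A} {c : ℂ}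
    (h : x * y = y * x + c • (u * v)) (z : A) :
    x * (y * z) = y * (x * z) + c • (u * (v * z)) := by
  rw [← mul_assoc, h, add_mul, smul_mul_assoc, mul_assoc, mul_assoc]

theorem flip_smul {A : Type*} [Ring A] [Algebra ℂ A] {x y : A} {c e : ℂ}
    (h : x = c • y) (hc : e * c = 1) : y = e • x := by
  rw [h, smul_smul, hc, one_smul]

/-- If `y x = j x y` with `1 + j + j² = 0`, then `(x + y)³ = x³ + y³`. -/
theorem cube_add {A : Type*} [Ring A] [Algebra ℂ A] {x y : A} {j : ℂ}
    (hj : j ^ 2 + j + 1 = 0) (h : y * x = j • (x * y)) (hx : x ^ 3 = 0) (hy : y ^ 3 = 0) :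
    (x + y) ^ 3 = 0 := by
  have e : (x + y) ^ 3 = x ^ 3 + y ^ 3 := by
    simp only [pow_succ, pow_zero, one_mul, add_mul, mul_add, mul_assoc, h, assoc_smul h,
      mul_smul_comm, smul_add, smul_mul_assoc, smul_smul]
    match_scalars <;> grind
  rw [e, hx, hy, add_zero]

theorem product_of_quantum_supermatrices_satisfies_GL_relations
    {A : Type*} [Ring A] [Algebra ℂ A] (q j : ℂ) (hq : q ≠ 0)
    (hj : j = Complex.exp (2 * Real.pi * Complex.I / 3))
    (a₁ β₁ γ₁ d₁ a₂ β₂ γ₂ d₂ : A)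
    (hT₁ : GLRel q j a₁ β₁ γ₁ d₁)
    (hT₂ : GLRel q j a₂ β₂ γ₂ d₂)
    (ha₁ : Commute a₁ a₂ ∧ Commute a₁ β₂ ∧ Commute a₁ γ₂ ∧ Commute a₁ d₂)
    (hd₁ : Commute d₁ a₂ ∧ Commute d₁ β₂ ∧ Commute d₁ γ₂ ∧ Commute d₁ d₂)
    (ha₂ : Commute a₂ a₁ ∧ Commute a₂ β₁ ∧ Commute a₂ γ₁ ∧ Commute a₂ d₁)
    (hd₂ : Commute d₂ a₁ ∧ Commute d₂ β₁ ∧ Commute d₂ γ₁ ∧ Commute d₂ d₁)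
    (hβγ : β₁ * γ₂ = j • (γ₂ * β₁))
    (hββ : β₁ * β₂ = (j ^ 2) • (β₂ * β₁))
    (hγβ : γ₁ * β₂ = j • (β₂ * γ₁))
    (hγγ : γ₁ * γ₂ = (j ^ 2) • (γ₂ * γ₁)) :
    GLRel q j (a₁ * a₂ + β₁ * γ₂) (a₁ * β₂ + β₁ * d₂)
      (γ₁ * a₂ + d₁ * γ₂) (γ₁ * β₂ + d₁ * d₂) := by
  have hj3 : j ^ 3 = 1 := by
    rw [hj, ← Complex.exp_nat_mul, ← Complex.exp_two_pi_mul_I]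
    congr 1; push_cast; ring
  have hj1 : j ≠ 1 := by
    intro h
    have := (Complex.isPrimitiveRoot_exp 3 (by norm_num)).ne_one (by norm_num)
    apply this
    rw [← h, hj]; norm_num
  have hj2 : j ^ 2 + j + 1 = 0 := by
    have : (j - 1) * (j ^ 2 + j + 1) = 0 := by linear_combination hj3
    exact (mul_eq_zero.mp this).resolve_left (sub_ne_zero.mpr hj1)
  have hji : j⁻¹ = j ^ 2 := by
    have : j ≠ 0 := by rintro rfl; norm_num at hj3
    field_simp; exact hj3.symm
  clear hj
  obtain ⟨p, hp⟩ : ∃ p, p = q⁻¹ := ⟨_, rfl⟩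
  have hpq : p * q = 1 := by rw [hp]; exact inv_mul_cancel₀ hq
  unfold GLRel at *
  rw [hji, ← hp] at *
  clear hp hji
  obtain ⟨ab1, db1, ag1, dg1, ad1, bg1, b1, g1⟩ := hT₁
  obtain ⟨ab2, db2, ag2, dg2, ad2, bg2, b2, g2⟩ := hT₂
  obtain ⟨-, c1, c2, -⟩ := ha₁
  obtain ⟨-, c3, c4, -⟩ := hd₁
  obtain ⟨c5, c6, c7, c8⟩ := ha₂
  obtain ⟨c9, c10, c11, c12⟩ := hd₂
  have c1 := c1.eq.symm
  have c2 := c2.eq.symm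
  have c3 := c3.eq.symm
  have c4 := c4.eq.symm
  have c5 := c5.eq
  have c6 := c6.eq
  have c7 := c7.eq
  have c8 := c8.eq
  have c9 := c9.eq
  have c10 := c10.eq
  have c11 := c11.eq
  have c12 := c12.eq
  have gb1 := flip_smul (e := p ^ 2) bg1 (by grind)
  have gb2 := flip_smul (e := p ^ 2) bg2 (by grind)
  have x1 := flip_smul (e := j ^ 2) hβγ (by grind)
  have x2 := flip_smul (e := j) hββ (by grind)
  have x3 := flip_smul (e := j ^ 2) hγβ (by grind)
  have x4 := flip_smul (e := j) hγγ (by grind)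
  clear bg1 bg2 hβγ hββ hγβ hγγ
  refine ⟨?_, ?_, ?_, ?_, ?_, ?_, ?_, ?_⟩
  iterate 6
    · simp only [add_mul, mul_add, mul_assoc, smul_mul_assoc, mul_smul_comm, smul_add, smul_smul,
      ab1, db1, ag1, dg1, gb1, ab2, db2, ag2, dg2, gb2, x1, x2, x3, x4, c1, c2, c3, c4,
      c5, c6, c7, c8, c9, c10, c11, c12, ad1, ad2, assoc_smul ab1, assoc_smul db1,
      assoc_smul ag1, assoc_smul dg1, assoc_smul gb1, assoc_smul ab2, assoc_smul db2,
      assoc_smul ag2, assoc_smul dg2, assoc_smul gb2, assoc_smul x1, assoc_smul x2,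
      assoc_smul x3, assoc_smul x4, assoc_comm c1, assoc_comm c2, assoc_comm c3,
      assoc_comm c4, assoc_comm c5, assoc_comm c6, assoc_comm c7, assoc_comm c8,
      assoc_comm c9, assoc_comm c10, assoc_comm c11, assoc_comm c12, assoc_add ad1,
      assoc_add ad2]
      all_goals (match_scalars <;> grind)
  · apply cube_add hj2
    · simp only [add_mul, mul_add, mul_assoc, smul_mul_assoc, mul_smul_comm, smul_add, smul_smul,
      ab1, db1, ag1, dg1, gb1, ab2, db2, ag2, dg2, gb2, x1, x2, x3, x4, c1, c2, c3, c4,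
      c5, c6, c7, c8, c9, c10, c11, c12, ad1, ad2, assoc_smul ab1, assoc_smul db1,
      assoc_smul ag1, assoc_smul dg1, assoc_smul gb1, assoc_smul ab2, assoc_smul db2,
      assoc_smul ag2, assoc_smul dg2, assoc_smul gb2, assoc_smul x1, assoc_smul x2,
      assoc_smul x3, assoc_smul x4, assoc_comm c1, assoc_comm c2, assoc_comm c3,
      assoc_comm c4, assoc_comm c5, assoc_comm c6, assoc_comm c7, assoc_comm c8,
      assoc_comm c9, assoc_comm c10, assoc_comm c11, assoc_comm c12, assoc_add ad1,
      assoc_add ad2]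
      all_goals (match_scalars <;> grind)
    · have h : Commute a₁ β₂ := c1.symm
      rw [h.mul_pow, b2, mul_zero]
    · have h : Commute β₁ d₂ := c10.symm
      rw [h.mul_pow, b1, zero_mul]
  · apply cube_add hj2
    · simp only [add_mul, mul_add, mul_assoc, smul_mul_assoc, mul_smul_comm, smul_add, smul_smul,
      ab1, db1, ag1, dg1, gb1, ab2, db2, ag2, dg2, gb2, x1, x2, x3, x4, c1, c2, c3, c4,
      c5, c6, c7, c8, c9, c10, c11, c12, ad1, ad2, assoc_smul ab1, assoc_smul db1,
      assoc_smul ag1, assoc_smul dg1, assoc_smul gb1, assoc_smul ab2, assoc_smul db2,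
      assoc_smul ag2, assoc_smul dg2, assoc_smul gb2, assoc_smul x1, assoc_smul x2,
      assoc_smul x3, assoc_smul x4, assoc_comm c1, assoc_comm c2, assoc_comm c3,
      assoc_comm c4, assoc_comm c5, assoc_comm c6, assoc_comm c7, assoc_comm c8,
      assoc_comm c9, assoc_comm c10, assoc_comm c11, assoc_comm c12, assoc_add ad1,
      assoc_add ad2]
      all_goals (match_scalars <;> grind)
    · have h : Commute γ₁ a₂ := c7.symm
      rw [h.mul_pow, g1, zero_mul]
    · have h : Commute d₁ γ₂ := c4.symm
      rw [h.mul_pow, g2, mul_zero]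
end

section
/- Let A be an associative unital ℂ-algebra, q ∈ ℂ with q ≠ 0 and q ≠ 1, and j = e^{2πi/3}. Suppose x', θ', h ∈ A satisfy x'θ' = qθ'x', θ'³ = 0, and h x' = x' h. Define x = x' and θ = θ' − (q−1)⁻¹ h x'. Then x θ = q θ x + h x². Moreover, if additionally θ h = q j h θ and h³ = 0, then θ³ = 0. -/
theorem h_deformation_aux {A : Type*} [Ring A] [Algebra ℂ A] (c j : ℂ)
    (hj : j ^ 2 + j + 1 = 0) (θ u : A) (hu : u ^ 3 = 0)
    (h1 : θ * u = j • (u * θ) - j • (u * u)) (h3 : (θ + c • u) ^ 3 = 0) : θ ^ 3 = 0 := by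
  have hj3 : j * j * j = 1 := by linear_combination (j - 1) * hj
  have hu' : u * (u * u) = 0 := by rw [← hu]; noncomm_ring
  have e1 : θ * (u * u) = (j * j) • (u * (u * θ)) := by
    rw [← mul_assoc, h1, sub_mul, smul_mul_assoc, smul_mul_assoc, mul_assoc, h1, mul_assoc u u u,
      hu', mul_sub, mul_smul_comm, mul_smul_comm, hu']
    simp [smul_smul]
  have e2 : θ * (u * θ) = j • (u * (θ * θ)) - j • (u * (u * θ)) := by
    rw [← mul_assoc, h1, sub_mul, smul_mul_assoc, smul_mul_assoc, mul_assoc, mul_assoc]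
  have e3 : θ * (θ * u) = (j * j) • (u * (θ * θ)) - (j * j + 1) • (u * (u * θ)) := by
    rw [h1, mul_sub, mul_smul_comm, mul_smul_comm, e1, e2, smul_sub, smul_smul, smul_smul,
      smul_smul, ← mul_assoc j j j, hj3, add_smul]
    abel
  have e4 : u * (θ * u) = j • (u * (u * θ)) := by
    rw [h1, mul_sub, mul_smul_comm, mul_smul_comm, hu']; simp
  have ex : (θ + c • u) ^ 3 = θ ^ 3 + c • (θ * (θ * u) + θ * (u * θ) + u * (θ * θ))
      + (c * c) • (θ * (u * u) + u * (θ * u) + u * (u * θ)) + (c * c * c) • (u * (u * u)) := by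
    simp only [pow_succ, pow_zero, one_mul, mul_add, add_mul, smul_mul_assoc, mul_smul_comm,
      smul_add, smul_smul, mul_assoc]
    abel
  have z1 : θ * (θ * u) + θ * (u * θ) + u * (θ * θ) = 0 := by
    rw [e3, e2]
    have : j * j = -1 - j := by linear_combination hj
    rw [this]; module
  have z2 : θ * (u * u) + u * (θ * u) + u * (u * θ) = 0 := by
    rw [e1, e4]
    have : j * j = -1 - j := by linear_combination hj
    rw [this]; module
  rw [ex, z1, z2, hu'] at h3
  simpa using h3

theorem h_deformation_of_quantum_superplane
    {A : Type*} [Ring A] [Algebra ℂ A] (q j : ℂ) (hq : q ≠ 0) (hq1 : q ≠ 1)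
    (hj : j = Complex.exp (2 * Real.pi * Complex.I / 3))
    (x' θ' h : A)
    (hxθ : x' * θ' = q • (θ' * x')) (hθ3 : θ' ^ 3 = 0)
    (hhx : h * x' = x' * h) :
    let x := x'
    let θ := θ' - (q - 1)⁻¹ • (h * x')
    x * θ = q • (θ * x) + h * x ^ 2 ∧
    (θ * h = (q * j) • (h * θ) → h ^ 3 = 0 → θ ^ 3 = 0) := by
  intro x θ
  have hq2 : q - 1 ≠ 0 := sub_ne_zero.mpr hq1
  have hjj : j ^ 2 + j + 1 = 0 := by
    have hp : IsPrimitiveRoot j 3 := by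
      rw [hj]; exact_mod_cast Complex.isPrimitiveRoot_exp 3 (by norm_num)
    have h3 := hp.pow_eq_one
    have h1 : j - 1 ≠ 0 := sub_ne_zero.mpr (hp.ne_one (by norm_num))
    apply mul_left_cancel₀ h1
    linear_combination h3
  have key : x' * θ = q • (θ * x') + h * x' ^ 2 := by
    have e : x' * (h * x') = h * x' ^ 2 := by rw [← mul_assoc, ← hhx, mul_assoc, pow_two]
    have e' : h * x' * x' = h * x' ^ 2 := by rw [mul_assoc, pow_two]
    simp only [θ]
    rw [mul_sub, sub_mul, mul_smul_comm, smul_mul_assoc, e, e', hxθ]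
    match_scalars <;> field_simp
    ring
  refine ⟨key, fun hθh hh => ?_⟩
  have hc : Commute h x' := hhx
  apply h_deformation_aux (q - 1)⁻¹ j hjj θ (h * x')
  · rw [hc.mul_pow, hh, zero_mul]
  · have k2 : q • (θ * x') = x' * θ - h * x' ^ 2 := by rw [key]; abel
    have k3 : h * x' * (h * x') = h * (h * x' ^ 2) := by
      rw [mul_assoc, ← mul_assoc x', ← hhx, mul_assoc h x' x', pow_two]
    rw [k3, ← mul_assoc, hθh, smul_mul_assoc, mul_assoc, mul_comm q j, mul_smul,
      ← mul_smul_comm, k2, mul_sub, smul_sub, mul_assoc]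
  · simpa [θ] using hθ3
end

section
/- Let A be an associative unital ℂ-algebra, q ∈ ℂ nonzero, and j = e^{2πi/3}. Suppose a, β, γ, d ∈ A satisfy the GL_{q,j}(1|1) relations, and suppose x, θ ∈ A satisfy xθ = qθx and θ³ = 0, where the entries j-commute with the coordinates as follows: a and d commute with x and θ, β and γ commute with x, θβ = j²βθ, and θγ = jγθ. Then the coordinates transformed by the Z₃-graded supertranspose Tˢᵗ = [[a, γ], [jβ, d]], namely x̂ = x a + j θ β and θ̂ = x γ + θ d, again satisfy the quantum superplane relations: x̂θ̂ = q θ̂ x̂ and θ̂³ = 0. -/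
theorem supertranspose_transformed_coordinates_satisfy_superplane_relations
    {A : Type*} [Ring A] [Algebra ℂ A] (q j : ℂ) (hq : q ≠ 0)
    (hj : j = Complex.exp (2 * Real.pi * Complex.I / 3))
    (a β γ d x θ : A)
    (hT : GLRel q j a β γ d)
    (hxθ : x * θ = q • (θ * x)) (hθ3 : θ ^ 3 = 0)
    (hax : a * x = x * a) (haθ : a * θ = θ * a)
    (hdx : d * x = x * d) (hdθ : d * θ = θ * d)
    (hβx : β * x = x * β) (hγx : γ * x = x * γ)
    (hθβ : θ * β = (j ^ 2) • (β * θ)) (hθγ : θ * γ = j • (γ * θ)) :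
    (x * a + j • (θ * β)) * (x * γ + θ * d) =
      q • ((x * γ + θ * d) * (x * a + j • (θ * β))) ∧
    (x * γ + θ * d) ^ 3 = 0 := by
  obtain ⟨-, h2, h3, h4, h5, h6, -, h8⟩ := hT
  have hj3 : j ^ 3 = 1 := by
    rw [hj, ← Complex.exp_nat_mul, ← Complex.exp_two_pi_mul_I]
    congr 1
    push_cast
    ring
  have hj1 : j ≠ 1 := by
    have hp : IsPrimitiveRoot (Complex.exp (2 * Real.pi * Complex.I / 3)) 3 := by
      simpa using Complex.isPrimitiveRoot_exp 3 (by norm_num)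
    rw [hj]
    exact hp.ne_one (by norm_num)
  have hs : 1 + j + j ^ 2 = 0 := by
    have h : (j - 1) * (1 + j + j ^ 2) = 0 := by linear_combination hj3
    exact (mul_eq_zero.mp h).resolve_left (sub_ne_zero.mpr hj1)
  have hβθ : β * θ = j • (θ * β) := by
    rw [hθβ, smul_smul, show j * j ^ 2 = 1 by linear_combination hj3, one_smul]
  have hγθ : γ * θ = (j ^ 2) • (θ * γ) := by
    rw [hθγ, smul_smul, show j ^ 2 * j = 1 by linear_combination hj3, one_smul]
  have ext : ∀ {u v w : A}, u * v = w → ∀ z, u * (v * z) = w * z := by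
    intro u v w h z
    rw [← mul_assoc, h]
  constructor
  · simp only [mul_add, add_mul, smul_mul_assoc, mul_smul_comm, mul_assoc, smul_add, smul_smul,
      hxθ, ext hxθ, hax, ext hax, haθ, ext haθ, hdx, ext hdx, hdθ, ext hdθ, hβx, ext hβx,
      hγx, ext hγx, hβθ, ext hβθ, hγθ, ext hγθ, h2, h3, h4, h5, h6]
    match_scalars <;> field_simp <;> grind
  · have hu : (x * γ) ^ 3 = 0 := by
      have hc : Commute x γ := hγx.symm
      rw [hc.mul_pow, h8, mul_zero]
    have hv : (θ * d) ^ 3 = 0 := by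
      have hc : Commute θ d := hdθ.symm
      rw [hc.mul_pow, hθ3, zero_mul]
    have huv : (x * γ) * (θ * d) = (j ^ 2) • ((θ * d) * (x * γ)) := by
      simp only [smul_mul_assoc, mul_smul_comm, mul_assoc, smul_smul,
        hxθ, ext hxθ, hdx, ext hdx, hγθ, ext hγθ, h4]
    generalize x * γ = u at *
    generalize θ * d = v at *
    have e : (u + v) ^ 3 = u ^ 3 + v ^ 3 + (1 + j ^ 2 + j ^ 4) • (v * (u * u))
        + (1 + j ^ 2 + j ^ 4) • (v * (v * u)) := by
      simp only [pow_succ u, pow_succ v, pow_succ (u + v), pow_zero, one_mul, mul_add, add_mul,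
        smul_mul_assoc, mul_smul_comm, mul_assoc, smul_smul, huv, ext huv]
      module
    rw [e, hu, hv, show 1 + j ^ 2 + j ^ 4 = 0 by linear_combination hs + j * hj3]
    simp
end
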